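/- arXiv:2412.02680 — 4 statements merged into one kernel-verified Lean document; each statement's English description precedes it below -/
import Mathlib

section
/- The structure constants R satisfy the recursion R_{{k₁,…,k_{a+1}},{l₁,…,l_{a+1}}} = R_{{k₁-1,k₂,…,k_{a+1}},{l₁,…,l_{a+1}}} + [C(k₁+l₁,k₁)·C(k₂+l₂,k₂)/C(k₁+k₂+l₁+l₂+1, k₁+k₂)] · R_{{0,0},{k₁+l₁,k₂+l₂}} · R_{{k₁+k₂,k₃,…,k_{a+1}},{l₁+l₂+1,l₃,…,l_{a+1}}}, where the first term is omitted when k₁ = 0 and the second term is omitted when a = 0, and where C(n,k) denotes the binomial coefficient and R_{{0,0},{p,q}} = (q+1)/(p+q+2). -/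
/-!
Statement 3: The structure constants R (defined by expanding products of symmetrized
monomials X^m(λ₁)X^n(λ₂) in the basis of symmetrized monomials separated by commutators
C = [X¹,X²]) satisfy the recursion
  R_{{k₁,…,k_{a+1}},{l₁,…,l_{a+1}}}
    = R_{{k₁-1,k₂,…},{l₁,…}}  (omitted when k₁ = 0)
      + [C(k₁+l₁,k₁)C(k₂+l₂,k₂)/C(k₁+k₂+l₁+l₂+1,k₁+k₂)] · R_{{0,0},{k₁+l₁,k₂+l₂}}
          · R_{{k₁+k₂,k₃,…},{l₁+l₂+1,l₃,…}}  (omitted when a = 0),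
with R_{{0,0},{p,q}} = (q+1)/(p+q+2).
-/

noncomputable section

open scoped BigOperators

abbrev FA := FreeAlgebra ℂ (Fin 2)

def Xg (i : Fin 2) : FA := FreeAlgebra.ι ℂ i

def Cc : FA := Xg 0 * Xg 1 - Xg 1 * Xg 0

def Xs (l : ℂ × ℂ) : FA := l.1 • Xg 0 + l.2 • Xg 1

def bra (l₁ l₂ : ℂ × ℂ) : ℂ := l₁.1 * l₂.2 - l₁.2 * l₂.1

/-- the doubly-graded symmetrized monomial `X^{k,l}(λ₁,λ₂)` -/
def Xkl (l₁ l₂ : ℂ × ℂ) (k l : ℕ) : FA :=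
  ((Nat.choose (k + l) k : ℂ))⁻¹ •
    ∑ S ∈ Finset.powersetCard k (Finset.univ : Finset (Fin (k + l))),
      (List.ofFn fun i => if i ∈ S then Xs l₁ else Xs l₂).prod

/-- the chain `X^{k₁,l₁}(λ₁,λ₂)·C·X^{k₂,l₂}(λ₁,λ₂)·C⋯C·X^{k_{a+1},l_{a+1}}(λ₁,λ₂)` -/
def chain (l₁ l₂ : ℂ × ℂ) {a : ℕ} (ks ls : Fin a → ℕ) : FA :=
  ((List.ofFn fun i => Xkl l₁ l₂ (ks i) (ls i)).intersperse Cc).prod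

/-- `R` is the family of structure constants of the celestial expansion:
`X^m(λ₁)X^n(λ₂) = Σ_{a=0}^{min(m,n)} [12]^a Σ_{Σkᵢ=m-a, Σlⱼ=n-a} R_{{kᵢ},{lⱼ}}
X^{k₁,l₁}C⋯CX^{k_{a+1},l_{a+1}}`. -/
def SatisfiesExpansion (R : List ℕ → List ℕ → ℂ) : Prop :=
  ∀ (m n : ℕ) (l₁ l₂ : ℂ × ℂ),
    Xs l₁ ^ m * Xs l₂ ^ n =
      ∑ a ∈ Finset.range (min m n + 1),
        bra l₁ l₂ ^ a •
          ∑ ks ∈ Finset.Nat.antidiagonalTuple (a + 1) (m - a),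
            ∑ ls ∈ Finset.Nat.antidiagonalTuple (a + 1) (n - a),
              R (List.ofFn ks) (List.ofFn ls) • chain l₁ l₂ ks ls


open Finset in
theorem mul_pow_succ_sub_pow_succ_mul {B : Type*} [Ring B] (a z : B) (n : ℕ) :
    a * z ^ (n + 1) - z ^ (n + 1) * a =
      ∑ ij ∈ antidiagonal n, z ^ ij.1 * (a * z - z * a) * z ^ ij.2 := by
  induction n with
  | zero => simp
  | succ n ih =>
    simp only [Nat.antidiagonal_succ', sum_cons, sum_map, Function.Embedding.coe_prodMap,
      Prod.map, Function.Embedding.refl_apply, Function.Embedding.coeFn_mk, pow_zero, mul_one,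
      Nat.succ_eq_add_one]
    simp only [pow_succ _ (_ + 1), pow_succ z (Prod.snd _), ← mul_assoc, ← sum_mul]
    rw [← ih]
    noncomm_ring

open Polynomial Finset in
theorem succ_nsmul_C_mul_linear_pow {A : Type*} [Ring A] (a b : A) (n : ℕ) :
    (n + 2) • (C a * (C a * X + C b) ^ (n + 1)) = derivative ((C a * X + C b) ^ (n + 2)) +
      ∑ ij ∈ antidiagonal n, (ij.2 + 1) •
        ((C a * X + C b) ^ ij.1 * C (a * b - b * a) * (C a * X + C b) ^ ij.2) := by
  set z : A[X] := C a * X + C b with hz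
  have hD : derivative z = C a := by simp [hz]
  have hC : C (a * b - b * a) = C a * z - z * C a := by
    simp only [hz, C_sub, C_mul, mul_add, add_mul, mul_assoc, X_mul_C]
    abel
  rw [hC]
  clear_value z
  induction n with
  | zero => simp [pow_succ, derivative_mul, hD, two_mul]
  | succ n ih =>
    have key := mul_pow_succ_sub_pow_succ_mul (C a) z (n + 1)
    have hsum : ∑ ij ∈ antidiagonal (n + 1),
        (ij.2 + 1) • (z ^ ij.1 * (C a * z - z * C a) * z ^ ij.2) =
        (∑ ij ∈ antidiagonal n,
          (ij.2 + 1) • (z ^ ij.1 * (C a * z - z * C a) * z ^ ij.2)) * z +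
        (C a * z ^ (n + 2) - z ^ (n + 2) * C a) := by
      rw [key]
      simp only [Nat.antidiagonal_succ', sum_cons, sum_map, Function.Embedding.coe_prodMap,
        Prod.map, Function.Embedding.refl_apply, Function.Embedding.coeFn_mk, pow_zero, mul_one,
        Nat.succ_eq_add_one, pow_succ z (Prod.snd _),
        ← mul_assoc, succ_nsmul, sum_add_distrib, add_mul, sum_mul, smul_mul_assoc]
      abel
    have hder : derivative (z ^ (n + 1 + 2)) =
        derivative (z ^ (n + 2)) * z + z ^ (n + 2) * C a := by
      rw [show n + 1 + 2 = n + 2 + 1 from rfl, pow_succ, derivative_mul, hD]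
    rw [hsum, hder, ← sub_eq_iff_eq_add.2 ih]
    rw [show n + 1 + 2 = (n + 2) + 1 from rfl, add_smul _ 1, sub_mul, one_smul, smul_mul_assoc,
      mul_assoc, ← pow_succ]
    abel

open Polynomial in
theorem prod_map_ite_C_mul_X {A ι : Type*} [Semiring A] (a b : A) (p : ι → Prop) [DecidablePred p]
    (l : List ι) :
    (l.map fun i => if p i then C a * X else C b).prod =
      monomial (l.countP p) ((l.map fun i => if p i then a else b).prod) := by
  induction l with
  | nil => simp
  | cons i l ih =>
    by_cases h : p i
    · rw [List.map_cons, List.prod_cons, ih, List.map_cons, List.prod_cons]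
      simp [h, C_mul_X_eq_monomial, monomial_mul_monomial, add_comm]
    · simp [h, ih, C_mul_monomial]

theorem countP_finRange_mem {n : ℕ} (S : Finset (Fin n)) :
    (List.finRange n).countP (· ∈ S) = S.card := by
  rw [List.countP_eq_length_filter, ← List.toFinset_card_of_nodup
    ((List.nodup_finRange n).filter _)]
  congr 1
  ext i
  simp

open Polynomial Finset in
theorem coeff_linear_pow {A : Type*} [Ring A] [Algebra ℂ A] (a b : A) (n k : ℕ) :
    ((C a * X + C b) ^ n).coeff k =
      ∑ S ∈ powersetCard k (univ : Finset (Fin n)),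
        (List.ofFn fun i => if i ∈ S then a else b).prod := by
  have h := (MultilinearMap.mkPiAlgebraFin ℂ n A[X]).map_add_univ
    (fun _ => C a * X) (fun _ => C b)
  have h2 : ∀ S : Finset (Fin n), (List.ofFn
      (S.piecewise (fun _ => C a * X) (fun _ => C b))).prod =
      monomial S.card ((List.ofFn fun i => if i ∈ S then a else b).prod) := by
    intro S
    rw [← countP_finRange_mem S, List.ofFn_eq_map, List.ofFn_eq_map, ← prod_map_ite_C_mul_X]
    rfl
  simp only [MultilinearMap.mkPiAlgebraFin_apply, h2] at h
  have h3 : (List.ofFn ((fun _ => C a * X) + (fun _ => C b) : Fin n → A[X])).prod =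
      (C a * X + C b) ^ n := by
    simp [Pi.add_def]
  rw [h3] at h
  rw [h, finsetSum_coeff]
  simp only [coeff_monomial]
  rw [← sum_filter]
  congr 1
  ext S
  simp [mem_powersetCard]

theorem Xs_one_zero : Xs (1, 0) = Xg 0 := by simp [Xs]

theorem Xs_zero_one : Xs (0, 1) = Xg 1 := by simp [Xs]

theorem bra_one_zero_zero_one : bra (1, 0) (0, 1) = 1 := by simp [bra]

/-- The symmetrized monomial in the generators themselves. -/
abbrev symMon (k l : ℕ) : FA := Xkl (1, 0) (0, 1) k l

theorem choose_add_left_ne_zero (k l : ℕ) : ((k + l).choose k : ℂ) ≠ 0 :=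
  Nat.cast_ne_zero.2 (Nat.choose_pos (Nat.le_add_right k l)).ne'

open Polynomial in
theorem coeff_generator_pow (k l : ℕ) :
    ((C (Xg 0) * X + C (Xg 1)) ^ (k + l)).coeff k = ((k + l).choose k : ℂ) • symMon k l := by
  rw [coeff_linear_pow, symMon, Xkl, smul_inv_smul₀ (choose_add_left_ne_zero k l),
    Xs_one_zero, Xs_zero_one]

open Polynomial in
theorem coeff_generator_pow_of_lt {n k : ℕ} (h : n < k) :
    ((C (Xg 0) * X + C (Xg 1)) ^ n).coeff k = 0 := by
  rw [coeff_linear_pow, Finset.powersetCard_eq_empty.2 (by simpa using h), Finset.sum_empty]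

theorem symMon_zero_right (k : ℕ) : symMon k 0 = Xg 0 ^ k := by
  have h : Finset.powersetCard k (Finset.univ : Finset (Fin (k + 0))) = {Finset.univ} := by
    simpa using Finset.powersetCard_self (Finset.univ : Finset (Fin (k + 0)))
  rw [symMon, Xkl, h]
  simp [Xs_one_zero]

/-- The coefficient of `X^{k₁,l₁} C X^{k₂,l₂}` in `X¹ * X^{k₁+k₂,l₁+l₂+1}`. -/
def splitCoeff (k₁ l₁ k₂ l₂ : ℕ) : ℂ :=
  (Nat.choose (k₁ + l₁) k₁ : ℂ) * (Nat.choose (k₂ + l₂) k₂ : ℂ) /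
      (Nat.choose (k₁ + k₂ + l₁ + l₂ + 1) (k₁ + k₂) : ℂ) *
    (((k₂ + l₂ + 1 : ℕ) : ℂ) / ((k₁ + l₁ + k₂ + l₂ + 2 : ℕ) : ℂ))

open Polynomial Finset in
theorem sum_antidiagonal_coeff_generator_pow (c : FA) (p q : ℕ) :
    ∑ ij ∈ antidiagonal (p + q), (ij.2 + 1) • ((C (Xg 0) * X + C (Xg 1)) ^ ij.1 * C c *
        (C (Xg 0) * X + C (Xg 1)) ^ ij.2).coeff p =
      ∑ k ∈ antidiagonal p, ∑ l ∈ antidiagonal q,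
        (((k.1 + l.1).choose k.1 : ℂ) * ((k.2 + l.2).choose k.2 : ℂ) * ((k.2 + l.2 + 1 : ℕ) : ℂ)) •
          (symMon k.1 l.1 * c * symMon k.2 l.2) := by
  simp only [coeff_mul _ _ p, coeff_mul_C, smul_sum]
  rw [sum_comm]
  refine sum_congr rfl fun k hk => ?_
  rw [HasAntidiagonal.mem_antidiagonal] at hk
  symm
  refine sum_of_injOn (fun l => (k.1 + l.1, k.2 + l.2)) ?_ ?_ ?_ ?_
  · rintro ⟨a, b⟩ - ⟨c, d⟩ - h
    simpa using h
  · rintro ⟨a, b⟩ h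
    simp at h ⊢
    omega
  · rintro ⟨i, j⟩ hij h
    rw [HasAntidiagonal.mem_antidiagonal] at hij
    rcases lt_or_ge i k.1 with hi | hi
    · simp [coeff_generator_pow_of_lt hi]
    rcases lt_or_ge j k.2 with hj | hj
    · simp [coeff_generator_pow_of_lt hj]
    refine absurd ⟨(i - k.1, j - k.2), ?_, ?_⟩ h
    · simp at hij ⊢
      omega
    · simp
      omega
  · rintro ⟨a, b⟩ -
    simp only [coeff_generator_pow, smul_mul_assoc, mul_smul_comm, smul_smul,
      ← Nat.cast_smul_eq_nsmul ℂ]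
    congr 1
    push_cast
    ring

open Polynomial Finset in
theorem generator_mul_symMon_succ (p q : ℕ) :
    Xg 0 * symMon p (q + 1) = symMon (p + 1) (q + 1) +
      ∑ k ∈ antidiagonal p, ∑ l ∈ antidiagonal q,
        splitCoeff k.1 l.1 k.2 l.2 • (symMon k.1 l.1 * Cc * symMon k.2 l.2) := by
  have h := congrArg (coeff · p) (succ_nsmul_C_mul_linear_pow (Xg 0) (Xg 1) (p + q))
  simp only [coeff_add, coeff_derivative, coeff_smul, finsetSum_coeff, coeff_C_mul,
    sum_antidiagonal_coeff_generator_pow] at h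
  rw [show p + q + 1 = p + (q + 1) from rfl,
    show (C (Xg 0) * X + C (Xg 1)) ^ (p + q + 2) = (C (Xg 0) * X + C (Xg 1)) ^ (p + 1 + (q + 1)) by
      ring_nf, coeff_generator_pow, coeff_generator_pow, ← Cc] at h
  have hc := choose_add_left_ne_zero p (q + 1)
  have hn : ((p + q + 2 : ℕ) : ℂ) ≠ 0 := Nat.cast_ne_zero.2 (by omega)
  have hch : ((p + 1 + (q + 1)).choose (p + 1) : ℂ) * (p + 1) =
      (p + q + 2 : ℕ) * (p + (q + 1)).choose p := by
    rw [show p + 1 + (q + 1) = p + (q + 1) + 1 by ring]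
    exact_mod_cast (Nat.add_one_mul_choose_eq (p + (q + 1)) p).symm
  refine smul_right_injective FA (mul_ne_zero hn hc) ?_
  have hcast : ∀ f : FA, f * ((p : FA) + 1) = ((p : ℂ) + 1) • f := by
    intro f
    rw [mul_add, mul_one, add_smul, one_smul, Nat.cast_smul_eq_nsmul, nsmul_eq_mul,
      Nat.cast_comm]
  rw [hcast, smul_smul, mul_comm _ (Nat.cast _), hch, mul_smul_comm, ← Nat.cast_smul_eq_nsmul ℂ,
    smul_smul] at h
  simp only [smul_add, smul_sum, smul_smul]
  rw [h]
  congr 1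
  refine sum_congr rfl fun k hk => sum_congr rfl fun l hl => ?_
  rw [HasAntidiagonal.mem_antidiagonal] at hk hl
  congr 1
  have hd : k.1 + k.2 + l.1 + l.2 + 1 = p + (q + 1) := by omega
  have hd' : k.1 + l.1 + k.2 + l.2 + 2 = p + q + 2 := by omega
  rw [splitCoeff, hd, hd', hk]
  field_simp

/-- `X^{k₁,l₁} C X^{k₂,l₂} C ⋯` for a nonempty list of exponent pairs. -/
def listChain : List (ℕ × ℕ) → FA
  | [] => 0
  | p :: L => (((p :: L).map fun p => symMon p.1 p.2).intersperse Cc).prod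

theorem listChain_singleton (p : ℕ × ℕ) : listChain [p] = symMon p.1 p.2 := by
  simp [listChain]

theorem listChain_cons_cons (p q : ℕ × ℕ) (L : List (ℕ × ℕ)) :
    listChain (p :: q :: L) = symMon p.1 p.2 * Cc * listChain (q :: L) := by
  simp [listChain, mul_assoc]

theorem listChain_cons_eq_mul (L : List (ℕ × ℕ)) :
    ∃ f : FA, ∀ p : ℕ × ℕ, listChain (p :: L) = symMon p.1 p.2 * f := by
  cases L with
  | nil => exact ⟨1, fun p => by rw [listChain_singleton, mul_one]⟩
  | cons q L => exact ⟨Cc * listChain (q :: L), fun p => by rw [listChain_cons_cons, mul_assoc]⟩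

theorem chain_eq_listChain {a : ℕ} (ks ls : Fin (a + 1) → ℕ) :
    chain (1, 0) (0, 1) ks ls = listChain (List.ofFn fun i => (ks i, ls i)) := by
  rw [chain, List.ofFn_succ, List.ofFn_succ, listChain, List.map_cons, List.map_ofFn]
  rfl

section Independence

/-- Sequences of polynomials in the variables `(i, false)` and `(i, true)`. -/
abbrev PolySeq := ℕ → MvPolynomial (ℕ × Bool) ℂ

def diagOp : Module.End ℂ PolySeq where
  toFun f i := MvPolynomial.X (i, false) * f i
  map_add' f g := by ext1 i; simp [mul_add]
  map_smul' c f := by ext1 i; simp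

def shiftOp : Module.End ℂ PolySeq where
  toFun f i := MvPolynomial.X (i, true) * f i + if i = 0 then 0 else f (i - 1)
  map_add' f g := by ext1 i; by_cases h : i = 0 <;> simp [h, mul_add, add_add_add_comm]
  map_smul' c f := by ext1 i; by_cases h : i = 0 <;> simp [h]

/-- The representation of the free algebra by lower bidiagonal matrices. -/
def bidiagRep : FA →ₐ[ℂ] Module.End ℂ PolySeq :=
  FreeAlgebra.lift ℂ ![diagOp, shiftOp]

theorem bidiagRep_Xg_zero : bidiagRep (Xg 0) = diagOp := by simp [bidiagRep, Xg]

theorem bidiagRep_Xg_one : bidiagRep (Xg 1) = shiftOp := by simp [bidiagRep, Xg]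

/-- `f` vanishes before position `d`, where its value is `g`. -/
def LeadsAt (d : ℕ) (g : MvPolynomial (ℕ × Bool) ℂ) (f : PolySeq) : Prop :=
  (∀ j < d, f j = 0) ∧ f d = g

variable {d : ℕ} {g : MvPolynomial (ℕ × Bool) ℂ} {f : PolySeq}

theorem LeadsAt.diagOp (h : LeadsAt d g f) :
    LeadsAt d (MvPolynomial.X (d, false) * g) (diagOp f) :=
  ⟨fun j hj => by simp [_root_.diagOp, h.1 j hj], by simp [_root_.diagOp, h.2]⟩

theorem LeadsAt.shiftOp (h : LeadsAt d g f) :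
    LeadsAt d (MvPolynomial.X (d, true) * g) (shiftOp f) := by
  have h1 : ∀ j ≤ d, j ≠ 0 → f (j - 1) = 0 := fun j hj h0 => h.1 _ (by omega)
  refine ⟨fun j hj => ?_, ?_⟩
  · simpa [_root_.shiftOp, h.1 j hj] using h1 j hj.le
  · simpa [_root_.shiftOp, h.2] using h1 d le_rfl

theorem LeadsAt.Cc (h : LeadsAt d g f) :
    LeadsAt (d + 1) ((MvPolynomial.X (d + 1, false) - MvPolynomial.X (d, false)) * g)
      (bidiagRep Cc f) := by
  have key : ∀ j, bidiagRep _root_.Cc f j = if j = 0 then 0 else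
      (MvPolynomial.X (j, false) - MvPolynomial.X (j - 1, false)) * f (j - 1) := by
    intro j
    simp only [_root_.Cc, map_sub, map_mul, bidiagRep_Xg_zero, bidiagRep_Xg_one]
    by_cases hj : j = 0
    · simp [_root_.diagOp, _root_.shiftOp, hj]
      ring
    · simp [_root_.diagOp, _root_.shiftOp, hj]
      ring
  refine ⟨fun j hj => ?_, ?_⟩
  · rw [key]
    split_ifs with h0
    · rfl
    · rw [h.1 _ (by omega), mul_zero]
  · simp [key, h.2]

theorem LeadsAt.prod_map_ite {ι : Type*} (p : ι → Prop) [DecidablePred p] (l : List ι)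
    (h : LeadsAt d g f) :
    LeadsAt d (MvPolynomial.X (d, false) ^ l.countP p *
        MvPolynomial.X (d, true) ^ l.countP (¬ p ·) * g)
      (bidiagRep (l.map fun i => if p i then Xg 0 else Xg 1).prod f) := by
  induction l with
  | nil => simpa using h
  | cons i l ih =>
    rw [List.map_cons, List.prod_cons, map_mul, Module.End.mul_apply]
    by_cases hi : p i
    · rw [if_pos hi, bidiagRep_Xg_zero]
      convert ih.diagOp using 1
      simp [hi]
      ring
    · rw [if_neg hi, bidiagRep_Xg_one]
      convert ih.shiftOp using 1
      simp [hi]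
      ring

theorem LeadsAt.sum {ι : Type*} (s : Finset ι) (F : ι → PolySeq)
    (h : ∀ i ∈ s, LeadsAt d g (F i)) : LeadsAt d (s.card • g) (∑ i ∈ s, F i) := by
  refine ⟨fun j hj => ?_, ?_⟩
  · rw [Finset.sum_apply]
    exact Finset.sum_eq_zero fun i hi => (h i hi).1 j hj
  · rw [Finset.sum_apply, Finset.sum_congr rfl fun i hi => (h i hi).2, Finset.sum_const]

theorem LeadsAt.symMon (h : LeadsAt d g f) (k l : ℕ) :
    LeadsAt d (MvPolynomial.X (d, false) ^ k * MvPolynomial.X (d, true) ^ l * g)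
      (bidiagRep (symMon k l) f) := by
  have hsum := LeadsAt.sum (d := d)
    (g := MvPolynomial.X (d, false) ^ k * MvPolynomial.X (d, true) ^ l * g)
    (Finset.powersetCard k (Finset.univ : Finset (Fin (k + l))))
    (fun S => bidiagRep (List.ofFn fun i => if i ∈ S then Xg 0 else Xg 1).prod f) ?_
  · rw [Finset.card_powersetCard, Finset.card_fin] at hsum
    have hc := choose_add_left_ne_zero k l
    rw [_root_.symMon, Xkl, map_smul, map_sum, Xs_one_zero, Xs_zero_one, LinearMap.smul_apply,
      LinearMap.sum_apply]
    refine ⟨fun j hj => ?_, ?_⟩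
    · rw [Pi.smul_apply, hsum.1 j hj, smul_zero]
    · rw [Pi.smul_apply, hsum.2, ← Nat.cast_smul_eq_nsmul ℂ, inv_smul_smul₀ hc]
  · intro S hS
    rw [Finset.mem_powersetCard] at hS
    have h1 := countP_finRange_mem S
    have h2 := List.length_eq_countP_add_countP (· ∈ S) (l := List.finRange (k + l))
    have h3 := h.prod_map_ite (· ∈ S) (List.finRange (k + l))
    rw [List.length_finRange, h1, hS.2, Nat.add_left_cancel_iff] at h2
    rw [List.ofFn_eq_map]
    convert h3 using 3
    · rw [h1, hS.2]
    · simpa using congrArg (MvPolynomial.X (R := ℂ) (d, true) ^ ·) h2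

/-- The exponent of the leading monomial of `listChain L`. -/
def chainExponent : List (ℕ × ℕ) → (ℕ × Bool →₀ ℕ)
  | [] => 0
  | p :: L => .single (L.length, false) p.1 + .single (L.length, true) p.2 + chainExponent L

theorem chainExponent_apply_eq_zero {L : List (ℕ × ℕ)} {i : ℕ} (h : L.length ≤ i) (b : Bool) :
    chainExponent L (i, b) = 0 := by
  induction L with
  | nil => rfl
  | cons p L ih =>
    rw [List.length_cons] at h
    have hi : L.length ≠ i := by omega
    simp [chainExponent, ih (by omega), hi]

theorem chainExponent_injective {L M : List (ℕ × ℕ)} (hlen : L.length = M.length)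
    (h : chainExponent L = chainExponent M) : L = M := by
  induction L generalizing M with
  | nil => exact (List.eq_nil_of_length_eq_zero hlen.symm).symm
  | cons p L ih =>
    cases M with
    | nil => simp at hlen
    | cons q M =>
      rw [List.length_cons, List.length_cons, Nat.add_right_cancel_iff] at hlen
      have h1 := DFunLike.congr_fun h (L.length, false)
      have h2 := DFunLike.congr_fun h (L.length, true)
      simp [chainExponent, chainExponent_apply_eq_zero hlen.le,
        chainExponent_apply_eq_zero (le_refl M.length), hlen] at h1 h2
      obtain rfl : p = q := Prod.ext h1 h2
      rw [chainExponent, chainExponent, hlen, add_right_inj] at h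
      rw [ih hlen h]

/-- The common factor of the leading coefficients of chains with `n` commutators. -/
def commutatorFactor (n : ℕ) : MvPolynomial (ℕ × Bool) ℂ :=
  ∏ i ∈ Finset.range n, (MvPolynomial.X (i + 1, false) - MvPolynomial.X (i, false))

theorem commutatorFactor_ne_zero (n : ℕ) : commutatorFactor n ≠ 0 :=
  Finset.prod_ne_zero_iff.2 fun i _ => sub_ne_zero.2 fun h => by
    simpa using MvPolynomial.X_injective h

theorem leadsAt_listChain (p : ℕ × ℕ) (L : List (ℕ × ℕ)) :
    LeadsAt L.length
      (commutatorFactor L.length * MvPolynomial.monomial (chainExponent (p :: L)) 1)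
      (bidiagRep (listChain (p :: L)) (Pi.single 0 1)) := by
  have hmon : ∀ (p : ℕ × ℕ) (L : List (ℕ × ℕ)),
      MvPolynomial.monomial (chainExponent (p :: L)) (1 : ℂ) =
        MvPolynomial.X (L.length, false) ^ p.1 * MvPolynomial.X (L.length, true) ^ p.2 *
          MvPolynomial.monomial (chainExponent L) 1 := by
    intro p L
    simp [chainExponent, MvPolynomial.X_pow_eq_monomial, MvPolynomial.monomial_mul]
  induction L generalizing p with
  | nil =>
    have h0 : LeadsAt 0 1 (Pi.single 0 1) := ⟨by simp, by simp⟩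
    rw [listChain_singleton, hmon]
    simpa [commutatorFactor, chainExponent] using h0.symMon p.1 p.2
  | cons q L ih =>
    rw [listChain_cons_cons, map_mul, map_mul, Module.End.mul_apply, Module.End.mul_apply]
    have h := (ih q).Cc.symMon p.1 p.2
    rw [hmon p, List.length_cons, commutatorFactor, Finset.prod_range_succ, ← commutatorFactor]
    convert h using 1
    ring

theorem eq_zero_of_linearCombination_listChain_eq_zero (c : List (ℕ × ℕ) →₀ ℂ) (hnil : c [] = 0)
    (h : Finsupp.linearCombination ℂ listChain c = 0) : c = 0 := by
  have key : ∀ (n : ℕ) (L : List (ℕ × ℕ)), L.length = n + 1 → c L = 0 := by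
    intro n
    induction n using Nat.strong_induction_on with
    | _ n ih =>
      intro L hL
      have h1 := congrFun (LinearMap.congr_fun (congrArg bidiagRep h) (Pi.single 0 1)) n
      rw [Finsupp.linearCombination_apply, Finsupp.sum, map_sum, LinearMap.sum_apply,
        Finset.sum_apply] at h1
      have h2 : ∀ M ∈ c.support, bidiagRep (c M • listChain M) (Pi.single 0 1) n =
          commutatorFactor n *
            if M.length = n + 1 then MvPolynomial.monomial (chainExponent M) (c M) else 0 := by
        intro M _
        rw [map_smul, LinearMap.smul_apply, Pi.smul_apply]
        cases M with
        | nil => simp [hnil]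
        | cons p M =>
          have hlead := leadsAt_listChain p M
          rcases lt_trichotomy M.length n with hn | rfl | hn
          · rw [ih M.length hn (p :: M) rfl]
            simp
          · rw [hlead.2]
            simp [← mul_smul_comm, MvPolynomial.smul_monomial]
          · rw [hlead.1 n hn]
            simp [hn.ne']
      rw [Finset.sum_congr rfl h2, ← Finset.mul_sum, map_zero, LinearMap.zero_apply,
        Pi.zero_apply, mul_eq_zero, or_iff_right (commutatorFactor_ne_zero n)] at h1
      have h3 := congrArg (MvPolynomial.coeff (chainExponent L)) h1
      rw [MvPolynomial.coeff_sum, Finset.sum_eq_single L] at h3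
      · simpa [hL] using h3
      · intro M _ hM
        split_ifs with hlen
        · rw [MvPolynomial.coeff_monomial, if_neg]
          exact fun he => hM (chainExponent_injective (hlen.trans hL.symm) he)
        · simp
      · intro hn
        simp [Finsupp.notMem_support_iff.1 hn]
  ext L
  cases L with
  | nil => exact hnil
  | cons p L => exact key L.length (p :: L) rfl

end Independence

/-- The coordinates of `X¹ * listChain L` in the family `listChain`. -/
def genMulChain : List (ℕ × ℕ) → (List (ℕ × ℕ) →₀ ℂ)
  | [] => 0
  | (p, 0) :: L => .single ((p + 1, 0) :: L) 1
  | (p, q + 1) :: L => .single ((p + 1, q + 1) :: L) 1 +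
      ∑ k ∈ Finset.HasAntidiagonal.antidiagonal p, ∑ l ∈ Finset.HasAntidiagonal.antidiagonal q,
        .single ((k.1, l.1) :: (k.2, l.2) :: L) (splitCoeff k.1 l.1 k.2 l.2)

theorem linearCombination_genMulChain (L : List (ℕ × ℕ)) :
    Finsupp.linearCombination ℂ listChain (genMulChain L) = Xg 0 * listChain L := by
  match L with
  | [] => simp [genMulChain, listChain]
  | (p, 0) :: L =>
    obtain ⟨f, hf⟩ := listChain_cons_eq_mul L
    simp [genMulChain, hf, symMon_zero_right, pow_succ', mul_assoc]
  | (p, q + 1) :: L =>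
    obtain ⟨f, hf⟩ := listChain_cons_eq_mul L
    simp only [genMulChain, map_add, map_sum, Finsupp.linearCombination_single, one_smul,
      listChain_cons_cons, hf, ← mul_assoc]
    rw [generator_mul_symMon_succ]
    simp only [add_mul, Finset.sum_mul, smul_mul_assoc]

/-- Left multiplication by `X¹` in the coordinates given by `listChain`. -/
def genMul : (List (ℕ × ℕ) →₀ ℂ) →ₗ[ℂ] (List (ℕ × ℕ) →₀ ℂ) :=
  Finsupp.linearCombination ℂ genMulChain

theorem genMul_single (L : List (ℕ × ℕ)) (c : ℂ) :
    genMul (.single L c) = c • genMulChain L := by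
  simp [genMul]

theorem linearCombination_genMul (c : List (ℕ × ℕ) →₀ ℂ) :
    Finsupp.linearCombination ℂ listChain (genMul c) =
      Xg 0 * Finsupp.linearCombination ℂ listChain c := by
  induction c using Finsupp.induction_linear with
  | zero => simp
  | add f g hf hg => simp [hf, hg, mul_add]
  | single L c => simp [genMul_single, linearCombination_genMulChain]

theorem genMul_apply_nil (c : List (ℕ × ℕ) →₀ ℂ) : genMul c [] = 0 := by
  induction c using Finsupp.induction_linear with
  | zero => simp
  | add f g hf hg => simp [hf, hg]
  | single L c =>
    rw [genMul_single]
    match L with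
    | [] => simp [genMulChain]
    | (p, 0) :: L => simp [genMulChain]
    | (p, q + 1) :: L => simp [genMulChain]

theorem genMul_apply_singleton (c : List (ℕ × ℕ) →₀ ℂ) (k l : ℕ) :
    genMul c [(k + 1, l)] = c [(k, l)] := by
  induction c using Finsupp.induction_linear with
  | zero => simp
  | add f g hf hg => simp [hf, hg]
  | single L c =>
    rw [genMul_single]
    match L with
    | [] => simp [genMulChain]
    | (p, 0) :: L => simp [genMulChain, Finsupp.single_apply]
    | (p, q + 1) :: L => simp [genMulChain, Finsupp.single_apply]

theorem genMulChain_apply_cons_cons (M : List (ℕ × ℕ)) (k₁ l₁ k₂ l₂ : ℕ) (L : List (ℕ × ℕ)) :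
    genMulChain M ((k₁, l₁) :: (k₂, l₂) :: L) =
      (if k₁ = 0 then 0 else Finsupp.single M 1 ((k₁ - 1, l₁) :: (k₂, l₂) :: L)) +
        splitCoeff k₁ l₁ k₂ l₂ * Finsupp.single M 1 ((k₁ + k₂, l₁ + l₂ + 1) :: L) := by
  have hsucc : ∀ (p q : ℕ) (M : List (ℕ × ℕ)),
      Finsupp.single ((p + 1, q) :: M) (1 : ℂ) ((k₁, l₁) :: (k₂, l₂) :: L) =
        if k₁ = 0 then 0 else
          Finsupp.single ((p, q) :: M) 1 ((k₁ - 1, l₁) :: (k₂, l₂) :: L) := by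
    intro p q M
    cases k₁ <;> simp [Finsupp.single_apply]
  match M with
  | [] => simp [genMulChain]
  | (p, 0) :: M => simp [genMulChain, hsucc]
  | (p, q + 1) :: M =>
    rw [genMulChain, Finsupp.add_apply, hsucc, add_right_inj]
    simp only [Finsupp.finsetSum_apply]
    by_cases h : k₁ + k₂ = p ∧ l₁ + l₂ = q ∧ M = L
    · obtain ⟨rfl, rfl, rfl⟩ := h
      rw [Finset.sum_eq_single (k₁, k₂), Finset.sum_eq_single (l₁, l₂)]
      · simp
      · rintro ⟨a, b⟩ - hab
        rw [Finsupp.single_apply, if_neg]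
        rintro h
        simp_all
      · simp
      · rintro ⟨a, b⟩ - hab
        refine Finset.sum_eq_zero fun l _ => ?_
        rw [Finsupp.single_apply, if_neg]
        rintro h
        simp_all
      · simp
    · rw [Finsupp.single_apply (a := (p, q + 1) :: M), if_neg, mul_zero]
      · refine Finset.sum_eq_zero fun k hk => Finset.sum_eq_zero fun l hl => ?_
        rw [Finset.HasAntidiagonal.mem_antidiagonal] at hk hl
        rw [Finsupp.single_apply, if_neg]
        intro h'
        simp only [List.cons.injEq, Prod.mk.injEq] at h'
        grind
      · intro h'
        simp only [List.cons.injEq, Prod.mk.injEq] at h'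
        grind

theorem genMul_apply_cons_cons (c : List (ℕ × ℕ) →₀ ℂ) (k₁ l₁ k₂ l₂ : ℕ) (L : List (ℕ × ℕ)) :
    genMul c ((k₁, l₁) :: (k₂, l₂) :: L) =
      (if k₁ = 0 then 0 else c ((k₁ - 1, l₁) :: (k₂, l₂) :: L)) +
        splitCoeff k₁ l₁ k₂ l₂ * c ((k₁ + k₂, l₁ + l₂ + 1) :: L) := by
  induction c using Finsupp.induction_linear with
  | zero => simp
  | add f g hf hg =>
    rw [map_add, Finsupp.add_apply, hf, hg]
    split_ifs <;> simp <;> ring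
  | single M c =>
    have hc : ∀ N, Finsupp.single M c N = c * Finsupp.single M 1 N := by
      simp [Finsupp.single_apply]
    rw [genMul_single, Finsupp.smul_apply, genMulChain_apply_cons_cons, smul_eq_mul, hc, hc]
    split_ifs <;> ring

/-- The coefficients of the expansion of `X^m(λ₁) X^n(λ₂)` prescribed by `R`. -/
def expansionCoeffs (R : List ℕ → List ℕ → ℂ) (m n : ℕ) : List (ℕ × ℕ) →₀ ℂ :=
  ∑ a ∈ Finset.range (min m n + 1),
    ∑ ks ∈ Finset.Nat.antidiagonalTuple (a + 1) (m - a),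
      ∑ ls ∈ Finset.Nat.antidiagonalTuple (a + 1) (n - a),
        .single (List.ofFn fun i => (ks i, ls i)) (R (List.ofFn ks) (List.ofFn ls))

theorem expansionCoeffs_apply_nil (R : List ℕ → List ℕ → ℂ) (m n : ℕ) :
    expansionCoeffs R m n [] = 0 := by
  simp [expansionCoeffs, Finsupp.finsetSum_apply]

theorem expansionCoeffs_apply (R : List ℕ → List ℕ → ℂ) {a : ℕ} {L : List (ℕ × ℕ)}
    (hL : L.length = a + 1) {m n : ℕ} (hm : m = (L.map Prod.fst).sum + a)
    (hn : n = (L.map Prod.snd).sum + a) :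
    expansionCoeffs R m n L = R (L.map Prod.fst) (L.map Prod.snd) := by
  obtain ⟨F, rfl⟩ : ∃ F : Fin (a + 1) → ℕ × ℕ, L = List.ofFn F :=
    ⟨fun i => L.get (i.cast hL.symm), by rw [← List.ofFn_congr hL, List.ofFn_get]⟩
  simp only [List.map_ofFn, List.sum_ofFn] at hm hn ⊢
  simp only [expansionCoeffs, Finsupp.finsetSum_apply]
  rw [Finset.sum_eq_single a, Finset.sum_eq_single (Prod.fst ∘ F),
    Finset.sum_eq_single (Prod.snd ∘ F)]
  · simp
  · intro ls _ hls
    rw [Finsupp.single_apply, if_neg]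
    intro h
    exact hls (funext fun i => congrArg Prod.snd (congrFun (List.ofFn_injective h) i))
  · intro h
    exact absurd (Finset.Nat.mem_antidiagonalTuple.2 (by omega)) h
  · intro ks _ hks
    refine Finset.sum_eq_zero fun ls _ => ?_
    rw [Finsupp.single_apply, if_neg]
    intro h
    exact hks (funext fun i => congrArg Prod.fst (congrFun (List.ofFn_injective h) i))
  · intro h
    exact absurd (Finset.Nat.mem_antidiagonalTuple.2 (by omega)) h
  · intro b _ hb
    refine Finset.sum_eq_zero fun ks _ => Finset.sum_eq_zero fun ls _ => ?_
    rw [Finsupp.single_apply, if_neg]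
    intro h
    have := congrArg List.length h
    simp only [List.length_ofFn] at this
    omega
  · intro h
    exact absurd (Finset.mem_range.2 (by omega)) h

theorem linearCombination_expansionCoeffs {R : List ℕ → List ℕ → ℂ} (hR : SatisfiesExpansion R)
    (m n : ℕ) :
    Finsupp.linearCombination ℂ listChain (expansionCoeffs R m n) = Xg 0 ^ m * Xg 1 ^ n := by
  have h := hR m n (1, 0) (0, 1)
  rw [Xs_one_zero, Xs_zero_one, bra_one_zero_zero_one] at h
  simp only [one_pow, one_smul, chain_eq_listChain] at h
  simp only [h, expansionCoeffs, map_sum, Finsupp.linearCombination_single]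

theorem expansionCoeffs_succ {R : List ℕ → List ℕ → ℂ} (hR : SatisfiesExpansion R) (m n : ℕ) :
    expansionCoeffs R (m + 1) n = genMul (expansionCoeffs R m n) := by
  refine sub_eq_zero.1 (eq_zero_of_linearCombination_listChain_eq_zero _ ?_ ?_)
  · simp [expansionCoeffs_apply_nil, genMul_apply_nil]
  · rw [map_sub, linearCombination_genMul, linearCombination_expansionCoeffs hR,
      linearCombination_expansionCoeffs hR, pow_succ', mul_assoc, sub_self]

theorem statement3 (R : List ℕ → List ℕ → ℂ) (hR : SatisfiesExpansion R) :
    -- the case a = 0: the second term is omitted (and the first when k₁ = 0)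
    (∀ k l : ℕ, R [k + 1] [l] = R [k] [l]) ∧
    -- the case a ≥ 1: the first term is omitted when k₁ = 0
    (∀ (k₁ k₂ l₁ l₂ : ℕ) (ks ls : List ℕ), ks.length = ls.length →
      R (k₁ :: k₂ :: ks) (l₁ :: l₂ :: ls) =
        (if k₁ = 0 then 0 else R ((k₁ - 1) :: k₂ :: ks) (l₁ :: l₂ :: ls)) +
          ((Nat.choose (k₁ + l₁) k₁ : ℂ) * (Nat.choose (k₂ + l₂) k₂ : ℂ) /
              (Nat.choose (k₁ + k₂ + l₁ + l₂ + 1) (k₁ + k₂) : ℂ)) *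
            (((k₂ + l₂ + 1 : ℕ) : ℂ) / ((k₁ + l₁ + k₂ + l₂ + 2 : ℕ) : ℂ)) *
            R ((k₁ + k₂) :: ks) ((l₁ + l₂ + 1) :: ls)) := by
  refine ⟨fun k l => ?_, fun k₁ k₂ l₁ l₂ ks ls hlen => ?_⟩
  · have h := DFunLike.congr_fun (expansionCoeffs_succ hR k l) [(k + 1, l)]
    rwa [genMul_apply_singleton, expansionCoeffs_apply R (a := 0) rfl (by simp) (by simp),
      expansionCoeffs_apply R (a := 0) rfl (by simp) (by simp)] at h
  · obtain ⟨L, rfl, rfl⟩ : ∃ L : List (ℕ × ℕ), L.map Prod.fst = ks ∧ L.map Prod.snd = ls :=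
      ⟨ks.zip ls, List.map_fst_zip hlen.le, List.map_snd_zip hlen.ge⟩
    have h := DFunLike.congr_fun (expansionCoeffs_succ hR
      (k₁ + k₂ + (L.map Prod.fst).sum + L.length)
      (l₁ + l₂ + (L.map Prod.snd).sum + L.length + 1)) ((k₁, l₁) :: (k₂, l₂) :: L)
    rw [genMul_apply_cons_cons,
      expansionCoeffs_apply R (a := L.length + 1) (by simp) (by simp; ring) (by simp; ring),
      expansionCoeffs_apply R (a := L.length) (L := (k₁ + k₂, l₁ + l₂ + 1) :: L)
        (by simp) (by simp) (by simp; ring)] at h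
    rw [splitCoeff] at h
    simp only [List.map_cons] at h
    rw [h]
    congr 1
    split_ifs with h0
    · rfl
    · rw [expansionCoeffs_apply R (a := L.length + 1) (by simp) (by simp; omega) (by simp; ring)]
      simp

end
end

section
/- The two-index structure constants satisfy the closed formula R_{{k,k̃},{l,l̃}} = C(k+k̃+l+l̃+2, k+k̃+1)^{-1} · Σ_{p=0}^{k} C(k+l-p, l)·C(k̃+l̃+1+p, l̃), where C(n,m) denotes the binomial coefficient. -/
/-!
Statement 5: The two-index structure constants satisfy
  R_{{k,k̃},{l,l̃}} = C(k+k̃+l+l̃+2, k+k̃+1)⁻¹ · Σ_{p=0}^{k} C(k+l-p,l)·C(k̃+l̃+1+p,l̃).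
-/

noncomputable section

open scoped BigOperators

/-- The sum of all words of length `N` in `A` and `B` that contain the letter `A` exactly `k`
times. -/
def wordSum {M : Type*} [Semiring M] (A B : M) (N k : ℕ) : M :=
  ∑ S ∈ Finset.powersetCard k (Finset.univ : Finset (Fin N)),
    (List.ofFn fun i => if i ∈ S then A else B).prod

section wordSum

variable {M : Type*} [Semiring M] (A B : M)

theorem wordSum_zero_zero : wordSum A B 0 0 = 1 := by
  simp [wordSum]

theorem wordSum_zero_succ (k : ℕ) : wordSum A B 0 (k + 1) = 0 := by
  simp [wordSum]

theorem wordSum_succ_zero (N : ℕ) : wordSum A B (N + 1) 0 = B * wordSum A B N 0 := by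
  simp [wordSum, List.ofFn_succ]

theorem wordSum_succ_succ (N k : ℕ) :
    wordSum A B (N + 1) (k + 1) = A * wordSum A B N k + B * wordSum A B N (k + 1) := by
  have h0 (s : Finset (Fin N)) : (0 : Fin (N + 1)) ∉ s.map (Fin.succEmb N) := by
    simp [Fin.succ_ne_zero]
  have hu : (Finset.univ : Finset (Fin (N + 1))) =
      insert 0 ((Finset.univ : Finset (Fin N)).map (Fin.succEmb N)) := by
    rw [Fin.univ_succ, Finset.cons_eq_insert]; rfl
  unfold wordSum
  rw [hu, Finset.powersetCard_succ_insert (h0 _), Finset.sum_union, Finset.sum_image, add_comm,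
    Finset.powersetCard_map, Finset.powersetCard_map, Finset.sum_map, Finset.sum_map,
    Finset.mul_sum, Finset.mul_sum]
  · congr 1 <;> refine Finset.sum_congr rfl fun S _ => ?_
    · simp [List.ofFn_succ, Fin.succ_ne_zero]
    · simp [List.ofFn_succ, Fin.succ_ne_zero]
  · intro S hS T hT h
    rw [Finset.powersetCard_map] at hS hT
    simp only [Finset.coe_map, Set.mem_image, Finset.mem_coe] at hS hT
    obtain ⟨S, -, rfl⟩ := hS
    obtain ⟨T, -, rfl⟩ := hT
    have h' := congrArg (fun U => U.erase 0) h
    simpa [Finset.erase_insert (h0 _), Finset.mapEmbedding_apply] using h'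
  · rw [Finset.disjoint_left]
    intro S hS hS'
    rw [Finset.powersetCard_map] at hS
    obtain ⟨S, -, rfl⟩ := Finset.mem_map.1 hS
    obtain ⟨T, -, hT⟩ := Finset.mem_image.1 hS'
    change insert 0 T = S.map (Fin.succEmb N) at hT
    exact h0 S (hT ▸ Finset.mem_insert_self 0 T)

end wordSum

/-- Polynomials in two commuting variables. -/
abbrev BiPoly := Polynomial (Polynomial ℂ)

/-- The coefficient of the `a`-th power of the inner and the `c`-th power of the outer variable. -/
def biCoeff (p : BiPoly) (a c : ℕ) : ℂ := (p.coeff c).coeff a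

/-- The image of the first generator in upper triangular matrices. -/
def matX : Matrix (Fin 2) (Fin 2) BiPoly := !![Polynomial.C Polynomial.X, 0; 0, 1]

/-- The image of the second generator in upper triangular matrices. -/
def matY : Matrix (Fin 2) (Fin 2) BiPoly := !![Polynomial.X, 1; 0, 1]

/-- The triangular representation of the free algebra. It kills every product with two factors
`Cc`, and is faithful enough to separate the chains with exactly one. -/
def triRep : FA →ₐ[ℂ] Matrix (Fin 2) (Fin 2) BiPoly :=
  FreeAlgebra.lift ℂ ![matX, matY]

theorem triRep_Xg_zero : triRep (Xg 0) = matX := by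
  simp [triRep, Xg]

theorem triRep_Xg_one : triRep (Xg 1) = matY := by
  simp [triRep, Xg]

theorem matX_mul_zero (A : Matrix (Fin 2) (Fin 2) BiPoly) (j : Fin 2) :
    (matX * A) 0 j = Polynomial.C Polynomial.X * A 0 j := by
  rw [Matrix.mul_apply, Fin.sum_univ_two]; simp [matX]

theorem matX_mul_one (A : Matrix (Fin 2) (Fin 2) BiPoly) (j : Fin 2) :
    (matX * A) 1 j = A 1 j := by
  rw [Matrix.mul_apply, Fin.sum_univ_two]; simp [matX]

theorem matY_mul_zero (A : Matrix (Fin 2) (Fin 2) BiPoly) (j : Fin 2) :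
    (matY * A) 0 j = Polynomial.X * A 0 j + A 1 j := by
  rw [Matrix.mul_apply, Fin.sum_univ_two]; simp [matY]

theorem matY_mul_one (A : Matrix (Fin 2) (Fin 2) BiPoly) (j : Fin 2) :
    (matY * A) 1 j = A 1 j := by
  rw [Matrix.mul_apply, Fin.sum_univ_two]; simp [matY]

theorem triRep_Cc : triRep Cc = !![0, Polynomial.C Polynomial.X - 1; 0, 0] := by
  rw [Cc, map_sub, map_mul, map_mul, triRep_Xg_zero, triRep_Xg_one]
  rw [← Matrix.ext_iff]
  simp only [Fin.forall_fin_two, Matrix.sub_apply, matX_mul_zero, matX_mul_one, matY_mul_zero,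
    matY_mul_one]
  simp [matX, matY, Polynomial.X_mul_C]

theorem triRep_Xkl (k l : ℕ) :
    triRep (Xkl (1, 0) (0, 1) k l) =
      ((Nat.choose (k + l) k : ℂ))⁻¹ • wordSum matX matY (k + l) k := by
  rw [Xkl, map_smul, map_sum, wordSum, Xs_one_zero, Xs_zero_one]
  congr 1
  refine Finset.sum_congr rfl fun S _ => ?_
  rw [map_list_prod, List.map_ofFn]
  congr 2
  ext1 i
  simp only [Function.comp_apply]
  split_ifs
  · exact triRep_Xg_zero
  · exact triRep_Xg_one

theorem wordSum_mat_one_zero (N k : ℕ) : wordSum matX matY N k 1 0 = 0 := by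
  induction N generalizing k with
  | zero => cases k <;> simp [wordSum_zero_zero, wordSum_zero_succ]
  | succ N ih =>
    cases k <;>
      simp [wordSum_succ_zero, wordSum_succ_succ, matX_mul_one, matY_mul_one, ih]

theorem wordSum_mat_one_one (N k : ℕ) : wordSum matX matY N k 1 1 = (N.choose k : BiPoly) := by
  induction N generalizing k with
  | zero => cases k <;> simp [wordSum_zero_zero, wordSum_zero_succ]
  | succ N ih =>
    cases k <;>
      simp [wordSum_succ_zero, wordSum_succ_succ, matX_mul_one, matY_mul_one, ih,
        Nat.choose_succ_succ]

theorem wordSum_mat_zero_zero (k l : ℕ) :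
    wordSum matX matY (k + l) k 0 0 =
      ((k + l).choose k : BiPoly) * Polynomial.C Polynomial.X ^ k * Polynomial.X ^ l := by
  suffices h : ∀ N k, wordSum matX matY N k 0 0 =
      (N.choose k : BiPoly) * Polynomial.C Polynomial.X ^ k * Polynomial.X ^ (N - k) by
    simpa using h (k + l) k
  intro N
  induction N with
  | zero => intro k; cases k <;> simp [wordSum_zero_zero, wordSum_zero_succ]
  | succ N ih =>
    intro k
    cases k with
    | zero =>
      simp [wordSum_succ_zero, matY_mul_zero, ih, wordSum_mat_one_zero, pow_succ']
    | succ k =>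
      simp only [wordSum_succ_succ, Matrix.add_apply, matX_mul_zero, matY_mul_zero, ih,
        wordSum_mat_one_zero, Nat.choose_succ_succ]
      rcases lt_or_ge k N with h | h
      · obtain ⟨d, rfl⟩ := Nat.exists_eq_add_of_lt h
        have h1 : k + d + 1 - k = d + 1 := by omega
        have h2 : k + d + 1 - (k + 1) = d := by omega
        have h3 : k + d + 1 + 1 - (k + 1) = d + 1 := by omega
        simp [h1, h2, h3]
        ring
      · simp [Nat.choose_eq_zero_of_lt (Nat.lt_succ_of_le h), Nat.sub_eq_zero_of_le h]
        ring

theorem biCoeff_add (p q : BiPoly) (a c : ℕ) :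
    biCoeff (p + q) a c = biCoeff p a c + biCoeff q a c := by
  simp [biCoeff]

theorem biCoeff_sub (p q : BiPoly) (a c : ℕ) :
    biCoeff (p - q) a c = biCoeff p a c - biCoeff q a c := by
  simp [biCoeff]

theorem biCoeff_smul (r : ℂ) (p : BiPoly) (a c : ℕ) :
    biCoeff (r • p) a c = r * biCoeff p a c := by
  simp [biCoeff]

theorem biCoeff_sum {ι : Type*} (s : Finset ι) (p : ι → BiPoly) (a c : ℕ) :
    biCoeff (∑ i ∈ s, p i) a c = ∑ i ∈ s, biCoeff (p i) a c := by
  simp [biCoeff]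

theorem biCoeff_natCast (n a c : ℕ) :
    biCoeff (n : BiPoly) a c = if a = 0 ∧ c = 0 then (n : ℂ) else 0 := by
  simp only [biCoeff, Polynomial.coeff_natCast_ite, ite_and]
  cases a <;> cases c <;> simp

theorem biCoeff_X_mul (p : BiPoly) (a c : ℕ) :
    biCoeff (Polynomial.X * p) a c = if c = 0 then 0 else biCoeff p a (c - 1) := by
  cases c <;> simp [biCoeff]

theorem biCoeff_C_X_mul (p : BiPoly) (a c : ℕ) :
    biCoeff (Polynomial.C Polynomial.X * p) a c = if a = 0 then 0 else biCoeff p (a - 1) c := by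
  cases a <;> simp [biCoeff]

theorem biCoeff_C_X_pow_mul_X_pow (i j a c : ℕ) :
    biCoeff (Polynomial.C Polynomial.X ^ i * Polynomial.X ^ j) a c =
      if a = i ∧ c = j then 1 else 0 := by
  rw [biCoeff, ← map_pow, Polynomial.coeff_C_mul, Polynomial.coeff_X_pow]
  by_cases hc : c = j <;> simp [hc, Polynomial.coeff_X_pow]

theorem biCoeff_wordSum (N k a c : ℕ) :
    biCoeff (wordSum matX matY N k 0 1) a c =
      if a + c < N ∧ a ≤ k then
        ((a + c).choose a * (N - 1 - (a + c)).choose (k - a) : ℂ) else 0 := by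
  induction N generalizing k a c with
  | zero => cases k <;> simp [wordSum_zero_zero, wordSum_zero_succ, biCoeff]
  | succ N ih =>
    cases k with
    | zero =>
      have h : wordSum matX matY (N + 1) 0 0 1 =
          Polynomial.X * wordSum matX matY N 0 0 1 + ((N.choose 0 : ℕ) : BiPoly) := by
        simp [wordSum_succ_zero, matY_mul_zero, wordSum_mat_one_one]
      rw [h, biCoeff_add, biCoeff_X_mul, ih, biCoeff_natCast]
      rcases a with _ | a <;> rcases c with _ | c <;> simp
    | succ k =>
      have h : wordSum matX matY (N + 1) (k + 1) 0 1 =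
          Polynomial.C Polynomial.X * wordSum matX matY N k 0 1 +
            (Polynomial.X * wordSum matX matY N (k + 1) 0 1 + ((N.choose (k + 1) : ℕ) : BiPoly)) := by
        simp [wordSum_succ_succ, matX_mul_zero, matY_mul_zero, wordSum_mat_one_one]
      rw [h, biCoeff_add, biCoeff_add, biCoeff_C_X_mul, biCoeff_X_mul, ih, ih, biCoeff_natCast]
      rcases a with _ | a <;> rcases c with _ | c
      · simp
      · simp [Nat.sub_sub, add_comm]
      · simp [Nat.sub_sub, add_comm]
      · have h1 : N - 1 - (a + (c + 1)) = N - (a + 1 + (c + 1)) := by omega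
        have h2 : N - 1 - (a + 1 + c) = N - (a + 1 + (c + 1)) := by omega
        have h3 : ((a + 1 + (c + 1)).choose (a + 1) : ℂ) =
            (a + (c + 1)).choose a + (a + 1 + c).choose (a + 1) := by
          rw [show a + 1 + (c + 1) = (a + c + 1) + 1 by ring, Nat.choose_succ_succ,
            show a + (c + 1) = a + c + 1 by ring, show a + 1 + c = a + c + 1 by ring]
          push_cast; rfl
        by_cases hN : a + 1 + (c + 1) < N + 1 ∧ a ≤ k
        · have h4 : a + (c + 1) < N := by omega
          have h5 : a + 1 + c < N := by omega
          simp [hN, h4, h5, h1, h2, h3]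
          ring
        · have h4 : ¬ (a + (c + 1) < N ∧ a ≤ k) := by omega
          have h5 : ¬ (a + 1 + c < N ∧ a + 1 ≤ k + 1) := by omega
          have h6 : ¬ (a + 1 + (c + 1) < N + 1 ∧ a + 1 ≤ k + 1) := by omega
          simp only [Nat.add_sub_cancel, if_neg h4, if_neg h5, if_neg h6]
          simp

theorem triRep_Xkl_one_zero (k l : ℕ) : triRep (Xkl (1, 0) (0, 1) k l) 1 0 = 0 := by
  simp [triRep_Xkl, wordSum_mat_one_zero]

theorem triRep_Xkl_zero_zero (k l : ℕ) :
    triRep (Xkl (1, 0) (0, 1) k l) 0 0 = Polynomial.C Polynomial.X ^ k * Polynomial.X ^ l := by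
  have h : ((k + l).choose k : ℂ) ≠ 0 :=
    Nat.cast_ne_zero.2 (Nat.choose_pos (Nat.le_add_right k l)).ne'
  rw [triRep_Xkl, Matrix.smul_apply, wordSum_mat_zero_zero, mul_assoc, ← nsmul_eq_mul,
    ← Nat.cast_smul_eq_nsmul ℂ, smul_smul, inv_mul_cancel₀ h, one_smul]

theorem triRep_Xkl_one_one (k l : ℕ) : triRep (Xkl (1, 0) (0, 1) k l) 1 1 = 1 := by
  have h : ((k + l).choose k : ℂ) ≠ 0 :=
    Nat.cast_ne_zero.2 (Nat.choose_pos (Nat.le_add_right k l)).ne'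
  rw [triRep_Xkl, Matrix.smul_apply, wordSum_mat_one_one,
    ← nsmul_one (A := BiPoly) ((k + l).choose k), ← Nat.cast_smul_eq_nsmul ℂ, smul_smul, inv_mul_cancel₀ h, one_smul]

theorem chain_one (l₁ l₂ : ℂ × ℂ) (ks ls : Fin 1 → ℕ) :
    chain l₁ l₂ ks ls = Xkl l₁ l₂ (ks 0) (ls 0) := by
  simp [chain]

theorem chain_two (l₁ l₂ : ℂ × ℂ) (ks ls : Fin 2 → ℕ) :
    chain l₁ l₂ ks ls = Xkl l₁ l₂ (ks 0) (ls 0) * Cc * Xkl l₁ l₂ (ks 1) (ls 1) := by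
  simp [chain, mul_assoc]

theorem chain_add_two (l₁ l₂ : ℂ × ℂ) {a : ℕ} (ks ls : Fin (a + 2) → ℕ) :
    chain l₁ l₂ ks ls =
      Xkl l₁ l₂ (ks 0) (ls 0) * Cc *
        chain l₁ l₂ (fun i => ks i.succ) (fun i => ls i.succ) := by
  simp [chain, List.ofFn_succ, mul_assoc]

theorem triRep_Cc_mul (A : Matrix (Fin 2) (Fin 2) BiPoly) (hA : A 1 0 = 0) :
    triRep Cc * A = !![0, (Polynomial.C Polynomial.X - 1) * A 1 1; 0, 0] := by
  refine Matrix.ext fun i j => ?_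
  rw [triRep_Cc, Matrix.mul_apply, Fin.sum_univ_two]
  fin_cases i <;> fin_cases j <;> simp [hA]

theorem triRep_chain_eq_zero {a : ℕ} (ks ls : Fin (a + 3) → ℕ) :
    triRep (chain (1, 0) (0, 1) ks ls) = 0 := by
  rw [chain_add_two, chain_add_two]
  have h : triRep Cc * triRep (Xkl (1, 0) (0, 1) (ks (Fin.succ 0)) (ls (Fin.succ 0))) *
      triRep Cc = 0 := by
    rw [triRep_Cc_mul _ (triRep_Xkl_one_zero _ _), triRep_Cc]
    refine Matrix.ext fun i j => ?_
    rw [Matrix.mul_apply, Fin.sum_univ_two]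
    fin_cases i <;> fin_cases j <;> simp
  simp only [map_mul]
  rw [mul_assoc, ← mul_assoc (triRep Cc), ← mul_assoc (triRep Cc), h, zero_mul, mul_zero]

theorem triRep_chain_two (ks ls : Fin 2 → ℕ) :
    triRep (chain (1, 0) (0, 1) ks ls) =
      !![0, (Polynomial.C Polynomial.X - 1) *
        (Polynomial.C Polynomial.X ^ ks 0 * Polynomial.X ^ ls 0); 0, 0] := by
  rw [chain_two, map_mul, map_mul, mul_assoc, triRep_Cc_mul _ (triRep_Xkl_one_zero _ _),
    triRep_Xkl_one_one]
  refine Matrix.ext fun i j => ?_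
  rw [Matrix.mul_apply, Fin.sum_univ_two, ← triRep_Xkl_zero_zero (ks 0) (ls 0)]
  fin_cases i <;> fin_cases j <;> simp [triRep_Xkl_one_zero, mul_comm]

/-- The part of the expansion of `Xg 0 ^ m * Xg 1 ^ n` with exactly `a` factors `Cc`. -/
def expansionTerm (R : List ℕ → List ℕ → ℂ) (m n a : ℕ) : FA :=
  ∑ ks ∈ Finset.Nat.antidiagonalTuple (a + 1) (m - a),
    ∑ ls ∈ Finset.Nat.antidiagonalTuple (a + 1) (n - a),
      R (List.ofFn ks) (List.ofFn ls) • chain (1, 0) (0, 1) ks ls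

theorem expansionTerm_zero (R : List ℕ → List ℕ → ℂ) (m n : ℕ) :
    expansionTerm R m n 0 = R [m] [n] • Xkl (1, 0) (0, 1) m n := by
  simp [expansionTerm, chain_one]

theorem expansionTerm_one (R : List ℕ → List ℕ → ℂ) (m n : ℕ) :
    expansionTerm R (m + 1) (n + 1) 1 =
      ∑ p ∈ Finset.HasAntidiagonal.antidiagonal m, ∑ q ∈ Finset.HasAntidiagonal.antidiagonal n,
        R [p.1, p.2] [q.1, q.2] • chain (1, 0) (0, 1) ![p.1, p.2] ![q.1, q.2] := by
  unfold expansionTerm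
  simp only [Nat.reduceAdd, Nat.add_sub_cancel]
  rw [Finset.Nat.antidiagonalTuple_two, Finset.Nat.antidiagonalTuple_two, Finset.sum_map]
  refine Finset.sum_congr rfl fun p _ => ?_
  rw [Finset.sum_map]
  rfl

theorem triRep_expansionTerm_add_two (R : List ℕ → List ℕ → ℂ) (m n a : ℕ) :
    triRep (expansionTerm R m n (a + 2)) = 0 := by
  simp [expansionTerm, triRep_chain_eq_zero]

theorem triRep_expansion {R : List ℕ → List ℕ → ℂ} (hR : SatisfiesExpansion R) (m n : ℕ) :
    matX ^ (m + 1) * matY ^ (n + 1) =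
      R [m + 1] [n + 1] • triRep (Xkl (1, 0) (0, 1) (m + 1) (n + 1)) +
        ∑ p ∈ Finset.HasAntidiagonal.antidiagonal m, ∑ q ∈ Finset.HasAntidiagonal.antidiagonal n,
          R [p.1, p.2] [q.1, q.2] • triRep (chain (1, 0) (0, 1) ![p.1, p.2] ![q.1, q.2]) := by
  have hbra : bra (1, 0) (0, 1) = 1 := by simp [bra]
  have h : Xs (1, 0) ^ (m + 1) * Xs (0, 1) ^ (n + 1) =
      ∑ a ∈ Finset.range (min (m + 1) (n + 1) + 1),
        bra (1, 0) (0, 1) ^ a • expansionTerm R (m + 1) (n + 1) a :=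
    hR (m + 1) (n + 1) (1, 0) (0, 1)
  simp only [hbra, one_pow, one_smul, Xs_one_zero, Xs_zero_one] at h
  rw [← triRep_Xg_zero, ← triRep_Xg_one, ← map_pow, ← map_pow, ← map_mul, h,
    Nat.succ_min_succ, Finset.sum_range_succ', Finset.sum_range_succ', map_add, map_add,
    map_sum, Finset.sum_eq_zero fun a _ => triRep_expansionTerm_add_two R _ _ a, zero_add,
    expansionTerm_zero, expansionTerm_one, add_comm]
  simp only [map_sum, map_smul]

theorem structureConstant_singleton {R : List ℕ → List ℕ → ℂ} (hR : SatisfiesExpansion R)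
    (m n : ℕ) : R [m + 1] [n + 1] = 1 := by
  have hX (i : ℕ) : (matX ^ i) 1 1 = 1 ∧ (matX ^ i) 1 0 = 0 := by
    induction i with
    | zero => simp
    | succ i ih => simp [pow_succ', matX_mul_one, ih]
  have hY (i : ℕ) : (matY ^ i) 1 1 = 1 := by
    induction i with
    | zero => simp
    | succ i ih => simp [pow_succ', matY_mul_one, ih]
  have h := congrFun (congrFun (triRep_expansion hR m n) 1) 1
  rw [Matrix.mul_apply, Fin.sum_univ_two] at h
  simp only [hX, hY, Matrix.add_apply, Matrix.smul_apply, Matrix.sum_apply, triRep_chain_two,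
    triRep_Xkl_one_one] at h
  have h' := congrArg (fun p => biCoeff p 0 0) h
  simpa [biCoeff] using h'.symm

theorem matX_pow_mul_zero (i : ℕ) (A : Matrix (Fin 2) (Fin 2) BiPoly) (j : Fin 2) :
    (matX ^ i * A) 0 j = Polynomial.C Polynomial.X ^ i * A 0 j := by
  induction i with
  | zero => simp
  | succ i ih => rw [pow_succ', mul_assoc, matX_mul_zero, ih, pow_succ', mul_assoc]

theorem biCoeff_C_X_pow_mul (i : ℕ) (p : BiPoly) {a : ℕ} (c : ℕ) (h : a < i) :
    biCoeff (Polynomial.C Polynomial.X ^ i * p) a c = 0 := by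
  rw [biCoeff, ← map_pow, Polynomial.coeff_C_mul, Polynomial.coeff_X_pow_mul', if_neg h.not_ge]

theorem sum_antidiagonal_biCoeff (f : ℕ → ℕ → ℕ → ℕ → ℂ) {m n a c : ℕ} (ha : a ≤ m)
    (hc : c ≤ n) :
    ∑ p ∈ Finset.HasAntidiagonal.antidiagonal m, ∑ q ∈ Finset.HasAntidiagonal.antidiagonal n,
      f p.1 p.2 q.1 q.2 *
        biCoeff (Polynomial.C Polynomial.X ^ p.1 * Polynomial.X ^ q.1) a c =
      f a (m - a) c (n - c) := by
  simp only [biCoeff_C_X_pow_mul_X_pow]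
  rw [Finset.sum_eq_single (a, m - a), Finset.sum_eq_single (c, n - c)]
  · simp
  · rintro ⟨i, j⟩ h hne
    rw [Finset.HasAntidiagonal.mem_antidiagonal] at h
    have : c ≠ i := by rintro rfl; exact hne (by simp; omega)
    simp [this]
  · simp; omega
  · rintro ⟨i, j⟩ h hne
    rw [Finset.HasAntidiagonal.mem_antidiagonal] at h
    have : a ≠ i := by rintro rfl; exact hne (by simp; omega)
    simp [this]
  · simp; omega

theorem biCoeff_expansion {R : List ℕ → List ℕ → ℂ} (hR : SatisfiesExpansion R) {m n a c : ℕ}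
    (ha : a ≤ m) (hc : c ≤ n) :
    R [a, m - a] [c, n - c] =
      ((m + 1 + (n + 1)).choose (m + 1) : ℂ)⁻¹ *
          ((a + c).choose a * (m + n + 1 - (a + c)).choose (m + 1 - a)) +
        if a = 0 then 0 else R [a - 1, m - (a - 1)] [c, n - c] := by
  have h := congrArg (fun p => biCoeff p a c) (congrFun (congrFun (triRep_expansion hR m n) 0) 1)
  have hlt : a + c < m + 1 + (n + 1) ∧ a ≤ m + 1 := by omega
  have hsub : m + 1 + (n + 1) - 1 - (a + c) = m + n + 1 - (a + c) := by omega
  simp only [matX_pow_mul_zero, biCoeff_C_X_pow_mul _ _ _ (Nat.lt_succ_of_le ha),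
    structureConstant_singleton hR, one_smul, Matrix.add_apply, triRep_Xkl, Matrix.smul_apply,
    Matrix.sum_apply, triRep_chain_two, biCoeff_add, biCoeff_smul, biCoeff_sum, biCoeff_wordSum,
    if_pos hlt, hsub, Matrix.of_apply, Matrix.cons_val_zero, Matrix.cons_val_one, sub_mul, one_mul,
    biCoeff_sub, mul_sub, Finset.sum_sub_distrib] at h
  rw [sum_antidiagonal_biCoeff (fun i j k l => R [i, j] [k, l]) ha hc] at h
  simp only [biCoeff_C_X_mul] at h
  by_cases h0 : a = 0
  · simp only [h0, if_true, mul_zero, Finset.sum_const_zero] at h ⊢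
    linear_combination h
  · simp only [h0, if_false] at h ⊢
    rw [sum_antidiagonal_biCoeff (fun i j k l => R [i, j] [k, l]) (by omega) hc] at h
    linear_combination h

theorem structureConstant_pair {R : List ℕ → List ℕ → ℂ} (hR : SatisfiesExpansion R)
    {m n a c : ℕ} (ha : a ≤ m) (hc : c ≤ n) :
    R [a, m - a] [c, n - c] =
      ((m + 1 + (n + 1)).choose (m + 1) : ℂ)⁻¹ *
        ∑ j ∈ Finset.range (a + 1),
          ((j + c).choose j * (m + n + 1 - (j + c)).choose (m + 1 - j) : ℂ) := by
  induction a with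
  | zero => simpa using biCoeff_expansion hR ha hc
  | succ a ih =>
    rw [biCoeff_expansion hR ha hc, Finset.sum_range_succ, mul_add, if_neg a.succ_ne_zero,
      Nat.add_sub_cancel, ih (by omega), add_comm]

theorem statement5 (R : List ℕ → List ℕ → ℂ) (hR : SatisfiesExpansion R)
    (k k' l l' : ℕ) :
    R [k, k'] [l, l'] =
      ((Nat.choose (k + k' + l + l' + 2) (k + k' + 1) : ℂ))⁻¹ *
        ∑ p ∈ Finset.range (k + 1),
          (Nat.choose (k + l - p) l : ℂ) * (Nat.choose (k' + l' + 1 + p) l' : ℂ) := by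
  have h := structureConstant_pair hR (Nat.le_add_right k k') (Nat.le_add_right l l')
  rw [Nat.add_sub_cancel_left, Nat.add_sub_cancel_left,
    show k + k' + 1 + (l + l' + 1) = k + k' + l + l' + 2 by ring] at h
  rw [h, ← Finset.sum_range_reflect]
  congr 1
  refine Finset.sum_congr rfl fun p hp => ?_
  rw [Finset.mem_range] at hp
  obtain ⟨j, rfl⟩ := Nat.exists_eq_add_of_le (Nat.le_of_lt_succ hp)
  rw [show p + j + 1 - 1 - p = j by omega, show p + j + l - p = j + l by omega,
    show p + j + k' + (l + l') + 1 - (j + l) = p + k' + 1 + l' by omega,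
    show p + j + k' + 1 - j = p + k' + 1 by omega,
    show k' + l' + 1 + p = p + k' + 1 + l' by omega,
    Nat.choose_symm_add, Nat.choose_symm_add]

end
end

section
/- For m₁+m₂+m₃ even, with a = (m₁+m₂-m₃)/2, b = (m₁+m₃-m₂)/2, c = (m₂+m₃-m₁)/2 all non-negative integers, the coefficient c_{m₁,m₂,m₃} of [X¹,X²]^{(m₁+m₂+m₃)/2} in the expansion of X^{m₁}(λ₁)X^{m₂}(λ₂)X^{m₃}(λ₃) (stripped of the kinematic factor [12]^a[13]^b[23]^c) equals (1/((m₁+m₂+m₃)/2 + 1)!) · binomial(m₂, (m₂+m₃-m₁)/2). -/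
/-!
Statement 7: For m₁ = a+b, m₂ = a+c, m₃ = b+c (so that a = (m₁+m₂-m₃)/2, etc. are
non-negative integers and m₁+m₂+m₃ = 2(a+b+c) is even), the coefficient of
C^{(m₁+m₂+m₃)/2} in the expansion of X^{m₁}(λ₁)X^{m₂}(λ₂)X^{m₃}(λ₃) in the basis of
symmetrized monomials separated by commutators C = [X¹,X²] equals
  c_{m₁,m₂,m₃}·[12]^a[13]^b[23]^c  with  c_{m₁,m₂,m₃} = (1/((m₁+m₂+m₃)/2+1)!)·C(m₂, c),
where C(m₂,c) = binomial(m₂, (m₂+m₃-m₁)/2).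
-/

noncomputable section

open scoped BigOperators

/-- the fully symmetrized product `S(X¹^r X²^s)` -/
def symXX (r s : ℕ) : FA :=
  ((Nat.choose (r + s) r : ℂ))⁻¹ •
    ∑ S ∈ Finset.powersetCard r (Finset.univ : Finset (Fin (r + s))),
      (List.ofFn fun i => if i ∈ S then Xg 0 else Xg 1).prod

/-- the chain `S(X¹^{r₁}X²^{s₁})·C·⋯·C·S(X¹^{r_k}X²^{s_k})` -/
def chainOf (l : List (ℕ × ℕ)) : FA :=
  ((l.map fun p => symXX p.1 p.2).intersperse Cc).prod

/-- the basis chains containing at least one symmetrized factor of positive degree -/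
def posChainSet : Set FA :=
  {x | ∃ l : List (ℕ × ℕ), l ≠ [] ∧ (∃ p ∈ l, p ≠ (0, 0)) ∧ x = chainOf l}

/-- The sum of all words of length `n` in `X¹, X²` containing `X¹` exactly `r` times. -/
def subsetSum (n r : ℕ) : FA :=
  ∑ S ∈ Finset.powersetCard r (Finset.univ : Finset (Fin n)),
    (List.ofFn fun i => if i ∈ S then Xg 0 else Xg 1).prod

theorem symXX_eq_smul_subsetSum (r s : ℕ) :
    symXX r s = ((Nat.choose (r + s) r : ℂ))⁻¹ • subsetSum (r + s) r := rfl

theorem subsetSum_zero_zero : subsetSum 0 0 = 1 := by simp [subsetSum]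

theorem subsetSum_zero_succ (r : ℕ) : subsetSum 0 (r + 1) = 0 := by
  rw [subsetSum, Finset.powersetCard_eq_empty.2 (by simp), Finset.sum_empty]

theorem subsetSum_succ_zero (n : ℕ) : subsetSum (n + 1) 0 = Xg 1 * subsetSum n 0 := by
  simp [subsetSum, List.ofFn_succ]

theorem subsetSum_succ_succ (n r : ℕ) :
    subsetSum (n + 1) (r + 1) = Xg 0 * subsetSum n r + Xg 1 * subsetSum n (r + 1) := by
  have hu : (Finset.univ : Finset (Fin (n + 1))) =
      insert 0 (Finset.univ.map (Fin.succEmb n)) := by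
    ext i
    refine Fin.cases ?_ (fun j => ?_) i <;> simp
  have h0 : (0 : Fin (n + 1)) ∉ Finset.univ.map (Fin.succEmb n) := by simp
  have hmem : ∀ (S : Finset (Fin n)), (0 : Fin (n + 1)) ∉ S.map (Fin.succEmb n) := by simp
  rw [subsetSum, hu, Finset.powersetCard_succ_insert h0, Finset.sum_union, add_comm]
  · congr 1
    · rw [Finset.sum_image, Finset.powersetCard_map, Finset.sum_map, subsetSum, Finset.mul_sum]
      · refine Finset.sum_congr rfl fun S _ => ?_
        simp [List.ofFn_succ, Finset.mapEmbedding_apply]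
      · intro S hS T hT h
        have aux : ∀ U ∈ Finset.powersetCard r (Finset.univ.map (Fin.succEmb n)), 0 ∉ U :=
          fun U hU h => h0 ((Finset.mem_powersetCard.1 hU).1 h)
        rw [← Finset.erase_insert (aux S hS), ← Finset.erase_insert (aux T hT), h]
    · rw [Finset.powersetCard_map, Finset.sum_map, subsetSum, Finset.mul_sum]
      refine Finset.sum_congr rfl fun S _ => ?_
      simp [List.ofFn_succ, Finset.mapEmbedding_apply]
  · rw [Finset.disjoint_left]
    intro S hS hS'
    obtain ⟨T, -, rfl⟩ := Finset.mem_image.1 hS'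
    exact h0 ((Finset.mem_powersetCard.1 hS).1 (Finset.mem_insert_self _ _))

/-- The word in the generators spelled by a list of letters. -/
def wordProd (w : List (Fin 2)) : FA := (w.map Xg).prod

/-- The span of the words of degree `n` with one commutator inserted. -/
def commSpan (n : ℕ) : Submodule ℂ FA :=
  Submodule.span ℂ {x | ∃ u v : List (Fin 2), u.length + v.length + 2 = n ∧
    x = wordProd u * Cc * wordProd v}

theorem Xg_mul_mem_commSpan (i : Fin 2) {n : ℕ} {x : FA} (hx : x ∈ commSpan n) :
    Xg i * x ∈ commSpan (n + 1) := by
  induction hx using Submodule.span_induction with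
  | mem x h =>
    obtain ⟨u, v, h, rfl⟩ := h
    exact Submodule.subset_span ⟨i :: u, v, by simp; omega, by simp [wordProd, mul_assoc]⟩
  | zero => simp
  | add x y _ _ hx hy => rw [mul_add]; exact add_mem hx hy
  | smul c x _ hx => rw [mul_smul_comm]; exact Submodule.smul_mem _ _ hx

theorem mul_Xg_mem_commSpan (i : Fin 2) {n : ℕ} {x : FA} (hx : x ∈ commSpan n) :
    x * Xg i ∈ commSpan (n + 1) := by
  induction hx using Submodule.span_induction with
  | mem x h =>
    obtain ⟨u, v, h, rfl⟩ := h
    exact Submodule.subset_span ⟨u, v ++ [i], by simp; omega, by simp [wordProd, mul_assoc]⟩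
  | zero => simp
  | add x y _ _ hx hy => rw [add_mul]; exact add_mem hx hy
  | smul c x _ hx => rw [smul_mul_assoc]; exact Submodule.smul_mem _ _ hx

theorem Xg_one_mul_pow_sub_mem_commSpan (r s : ℕ) :
    Xg 1 * (Xg 0 ^ r * Xg 1 ^ s) - Xg 0 ^ r * Xg 1 ^ (s + 1) ∈ commSpan (r + s + 1) := by
  induction s with
  | zero =>
    induction r with
    | zero => simp
    | succ r ih =>
      have hC : Cc ∈ commSpan 2 :=
        Submodule.subset_span ⟨[], [], rfl, by simp [wordProd]⟩
      have hpow : ∀ k, Cc * Xg 0 ^ k ∈ commSpan (k + 2) := by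
        intro k
        induction k with
        | zero => simpa using hC
        | succ k ih => rw [pow_succ, ← mul_assoc]; exact mul_Xg_mem_commSpan _ ih
      have := sub_mem (Xg_mul_mem_commSpan 0 ih) (hpow r)
      convert! this using 1
      rw [Cc, pow_succ' (Xg 0)]
      simp only [pow_zero, mul_one, zero_add, pow_one]
      noncomm_ring
  | succ s ih =>
    have := mul_Xg_mem_commSpan 1 ih
    convert! this using 1
    rw [sub_mul, pow_succ _ (s + 1), pow_succ _ s]
    simp only [mul_assoc]

theorem wordProd_sub_mem_commSpan (w : List (Fin 2)) :
    ∃ r s, r + s = w.length ∧ wordProd w - Xg 0 ^ r * Xg 1 ^ s ∈ commSpan w.length := by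
  induction w with
  | nil => exact ⟨0, 0, rfl, by simp [wordProd]⟩
  | cons i w ih =>
    obtain ⟨r, s, h, hw⟩ := ih
    have hi := Xg_mul_mem_commSpan i hw
    have hcons : wordProd (i :: w) = Xg i * wordProd w := by simp [wordProd]
    rw [hcons, List.length_cons]
    fin_cases i
    · refine ⟨r + 1, s, by omega, ?_⟩
      simpa [mul_sub, pow_succ', mul_assoc] using hi
    · refine ⟨r, s + 1, by omega, ?_⟩
      have := add_mem hi (h ▸ Xg_one_mul_pow_sub_mem_commSpan r s)
      convert! this using 1
      simp [mul_sub]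

theorem subsetSum_sub_mem_commSpan (n r : ℕ) :
    subsetSum n r - (n.choose r : ℂ) • (Xg 0 ^ r * Xg 1 ^ (n - r)) ∈ commSpan n := by
  induction n generalizing r with
  | zero => cases r <;> simp [subsetSum_zero_zero, subsetSum_zero_succ]
  | succ n ih =>
    cases r with
    | zero =>
      have := Xg_mul_mem_commSpan 1 (ih 0)
      simpa [subsetSum_succ_zero, mul_sub, pow_succ'] using this
    | succ r =>
      have h := add_mem (Xg_mul_mem_commSpan 0 (ih r)) (Xg_mul_mem_commSpan 1 (ih (r + 1)))
      rcases lt_or_ge r n with hr | hr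
      · obtain ⟨s, rfl⟩ := Nat.exists_eq_add_of_lt hr
        have e₁ : r + s + 1 + 1 - (r + 1) = s + 1 := by omega
        have e₂ : r + s + 1 - (r + 1) = s := by omega
        have e₃ : r + s + 1 - r = s + 1 := by omega
        have e₄ : r + 1 + s + 1 = r + s + 1 + 1 := by omega
        rw [e₂, e₃] at h
        rw [e₁]
        have h' := Submodule.smul_mem _ ((r + s + 1).choose (r + 1) : ℂ)
          (Xg_one_mul_pow_sub_mem_commSpan (r + 1) s)
        rw [e₄] at h'
        convert! add_mem h h' using 1
        rw [subsetSum_succ_succ, Nat.choose_succ_succ, Nat.cast_add, add_smul, smul_sub, mul_sub,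
          mul_sub, mul_smul_comm, mul_smul_comm, ← mul_assoc (Xg 0), ← pow_succ']
        abel
      · have hz : n.choose (r + 1) = 0 := Nat.choose_eq_zero_of_lt (by omega)
        have e : n + 1 - (r + 1) = n - r := by omega
        rw [hz] at h
        rw [e, subsetSum_succ_succ, Nat.choose_succ_succ, hz]
        convert! h using 1
        simp only [Nat.cast_zero, zero_smul, add_zero, sub_zero, mul_sub, mul_smul_comm, pow_succ',
          mul_assoc]
        abel

theorem pow_mul_pow_sub_symXX_mem_commSpan (r s : ℕ) :
    Xg 0 ^ r * Xg 1 ^ s - symXX r s ∈ commSpan (r + s) := by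
  have hc : ((r + s).choose r : ℂ) ≠ 0 :=
    Nat.cast_ne_zero.2 (Nat.choose_pos (Nat.le_add_right r s)).ne'
  have := Submodule.smul_mem _ (-((r + s).choose r : ℂ)⁻¹) (subsetSum_sub_mem_commSpan (r + s) r)
  convert! this using 1
  rw [symXX_eq_smul_subsetSum, smul_sub, smul_smul, neg_mul, inv_mul_cancel₀ hc,
    Nat.add_sub_cancel_left]
  simp only [neg_smul, one_smul]
  abel

theorem chainOf_singleton (p : ℕ × ℕ) : chainOf [p] = symXX p.1 p.2 := by simp [chainOf]

theorem chainOf_cons (p : ℕ × ℕ) {l : List (ℕ × ℕ)} (hl : l ≠ []) :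
    chainOf (p :: l) = symXX p.1 p.2 * Cc * chainOf l := by
  obtain ⟨q, l, rfl⟩ := List.exists_cons_of_ne_nil hl
  simp [chainOf, mul_assoc]

theorem chainOf_append {l l' : List (ℕ × ℕ)} (hl : l ≠ []) (hl' : l' ≠ []) :
    chainOf (l ++ l') = chainOf l * Cc * chainOf l' := by
  induction l with
  | nil => exact absurd rfl hl
  | cons p l ih =>
    rcases eq_or_ne l [] with rfl | h
    · rw [List.singleton_append, chainOf_cons _ hl', chainOf_singleton]
    · rw [List.cons_append, chainOf_cons _ (by simp [h]), ih h, chainOf_cons _ h]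
      simp only [mul_assoc]

/-- The span of all the basis chains. -/
def chainSpan : Submodule ℂ FA := Submodule.span ℂ {x | ∃ l, l ≠ [] ∧ x = chainOf l}

theorem mul_Cc_mul_mem_chainSpan {x y : FA} (hx : x ∈ chainSpan) (hy : y ∈ chainSpan) :
    x * Cc * y ∈ chainSpan := by
  induction hx using Submodule.span_induction with
  | mem x h =>
    obtain ⟨l, hl, rfl⟩ := h
    induction hy using Submodule.span_induction with
    | mem y h =>
      obtain ⟨l', hl', rfl⟩ := h
      exact Submodule.subset_span ⟨l ++ l', by simp [hl], (chainOf_append hl hl').symm⟩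
    | zero => simp
    | add x y _ _ hx hy => rw [mul_add]; exact add_mem hx hy
    | smul c x _ hx => rw [mul_smul_comm]; exact Submodule.smul_mem _ _ hx
  | zero => simp
  | add x y _ _ hx hy => rw [add_mul, add_mul]; exact add_mem hx hy
  | smul c x _ hx => rw [smul_mul_assoc, smul_mul_assoc]; exact Submodule.smul_mem _ _ hx

theorem wordProd_mem_chainSpan (w : List (Fin 2)) : wordProd w ∈ chainSpan := by
  induction hn : w.length using Nat.strong_induction_on generalizing w with
  | _ n ih =>
    have hle : commSpan n ≤ chainSpan := by
      refine Submodule.span_le.2 ?_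
      rintro _ ⟨u, v, h, rfl⟩
      exact mul_Cc_mul_mem_chainSpan (ih u.length (by omega) u rfl) (ih v.length (by omega) v rfl)
    obtain ⟨r, s, h, hw⟩ := wordProd_sub_mem_commSpan w
    have hs := pow_mul_pow_sub_symXX_mem_commSpan r s
    rw [hn] at h hw
    rw [h] at hs
    have hsym : symXX r s ∈ chainSpan :=
      Submodule.subset_span ⟨[(r, s)], List.cons_ne_nil _ _, (chainOf_singleton (r, s)).symm⟩
    have := add_mem (add_mem (hle hw) (hle hs)) hsym
    simpa using this

theorem chainSpan_eq_top : chainSpan = ⊤ := by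
  refine (Submodule.eq_top_iff').2 fun x => ?_
  have key : ∀ x : FA, x ∈ Submodule.span ℂ (Set.range wordProd) := by
    intro x
    induction x using FreeAlgebra.induction with
    | grade0 c =>
      rw [Algebra.algebraMap_eq_smul_one]
      exact Submodule.smul_mem _ _ (Submodule.subset_span ⟨[], by simp [wordProd]⟩)
    | grade1 i => exact Submodule.subset_span ⟨[i], by simp [wordProd, Xg]⟩
    | add x y hx hy => exact add_mem hx hy
    | mul x y hx hy =>
      have := Submodule.mul_mem_mul hx hy
      rw [Submodule.span_mul_span] at this
      refine Submodule.span_mono ?_ this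
      rintro _ ⟨_, ⟨u, rfl⟩, _, ⟨v, rfl⟩, rfl⟩
      exact ⟨u ++ v, by simp [wordProd]⟩
  refine Submodule.span_le.2 ?_ (key x)
  rintro _ ⟨w, rfl⟩
  exact wordProd_mem_chainSpan w

theorem symXX_zero_zero : symXX 0 0 = 1 := by
  simp [symXX_eq_smul_subsetSum, subsetSum_zero_zero]

theorem chainOf_eq_Cc_pow {l : List (ℕ × ℕ)} (hl : l ≠ []) (h : ∀ p ∈ l, p = (0, 0)) :
    chainOf l = Cc ^ (l.length - 1) := by
  induction l with
  | nil => exact absurd rfl hl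
  | cons p l ih =>
    have hp : p = (0, 0) := h p (by simp)
    rcases eq_or_ne l [] with rfl | hl'
    · simp [chainOf_singleton, hp, symXX_zero_zero]
    · rw [chainOf_cons _ hl', ih hl' fun q hq => h q (by simp [hq]), hp, symXX_zero_zero, one_mul,
        ← pow_succ']
      have := List.length_pos_of_ne_nil hl'
      simp only [List.length_cons]
      congr 1
      omega

theorem exists_mem_posChainSpan_add_aeval (x : FA) :
    ∃ p ∈ Submodule.span ℂ posChainSet, ∃ q : Polynomial ℂ, x = p + Polynomial.aeval Cc q := by
  have hx : x ∈ Submodule.span ℂ posChainSet ⊔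
      LinearMap.range (Polynomial.aeval (R := ℂ) Cc).toLinearMap := by
    have : x ∈ chainSpan := chainSpan_eq_top ▸ Submodule.mem_top
    refine Submodule.span_le.2 ?_ this
    rintro _ ⟨l, hl, rfl⟩
    by_cases h : ∃ p ∈ l, p ≠ (0, 0)
    · exact Submodule.mem_sup_left (Submodule.subset_span ⟨l, hl, h, rfl⟩)
    · push Not at h
      refine Submodule.mem_sup_right ⟨Polynomial.X ^ (l.length - 1), ?_⟩
      simp [chainOf_eq_Cc_pow hl h]
  obtain ⟨p, hp, _, ⟨q, rfl⟩, h⟩ := Submodule.mem_sup.1 hx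
  exact ⟨p, hp, q, h.symm⟩

abbrev PlanePoly := MvPolynomial (Fin 2) ℂ

/-- The linear form `λ₁ x + λ₂ y`. -/
def linForm (l : ℂ × ℂ) : PlanePoly := l.1 • MvPolynomial.X 0 + l.2 • MvPolynomial.X 1

/-- The derivation `λ₁ ∂_y - λ₂ ∂_x`. -/
def symplDeriv (l : ℂ × ℂ) : Derivation ℂ PlanePoly PlanePoly :=
  l.1 • MvPolynomial.pderiv 1 - l.2 • MvPolynomial.pderiv 0

/-- The operator scaling polynomials of degree `d` by `1 / ((d + 1) (d + 2))`. -/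
def degScale : PlanePoly →ₗ[ℂ] PlanePoly :=
  (MvPolynomial.basisMonomials (Fin 2) ℂ).constr ℂ fun d =>
    (((d.degree : ℂ) + 1) * (d.degree + 2))⁻¹ • MvPolynomial.monomial d 1

theorem degScale_apply {f : PlanePoly} {d : ℕ} (hf : f.IsHomogeneous d) :
    degScale f = (((d : ℂ) + 1) * (d + 2))⁻¹ • f := by
  conv_lhs => rw [f.as_sum]
  conv_rhs => rw [f.as_sum]
  rw [map_sum, Finset.smul_sum]
  refine Finset.sum_congr rfl fun m hm => ?_
  have hd : m.degree = d := by
    by_contra h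
    exact MvPolynomial.mem_support_iff.1 hm (hf.coeff_eq_zero h)
  have h := (MvPolynomial.basisMonomials (Fin 2) ℂ).constr_basis ℂ (fun d =>
    (((d.degree : ℂ) + 1) * (d.degree + 2))⁻¹ • (MvPolynomial.monomial d 1 : PlanePoly)) m
  rw [MvPolynomial.coe_basisMonomials, hd] at h
  have hm : (MvPolynomial.monomial m (f.coeff m) : PlanePoly) =
      f.coeff m • MvPolynomial.monomial m 1 := by
    rw [MvPolynomial.smul_monomial, smul_eq_mul, mul_one]
  rw [hm, map_smul, smul_comm, degScale, h]

theorem symplDeriv_linForm (l m : ℂ × ℂ) : symplDeriv l (linForm m) = MvPolynomial.C (bra l m) := by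
  simp [symplDeriv, linForm, bra, MvPolynomial.pderiv_X, MvPolynomial.smul_eq_C_mul]

theorem isHomogeneous_linForm (l : ℂ × ℂ) : (linForm l).IsHomogeneous 1 := by
  simp only [linForm, MvPolynomial.smul_eq_C_mul]
  exact (MvPolynomial.isHomogeneous_C_mul_X _ _).add (MvPolynomial.isHomogeneous_C_mul_X _ _)

theorem isHomogeneous_symplDeriv (l : ℂ × ℂ) {f : PlanePoly} {d : ℕ} (hf : f.IsHomogeneous d) :
    (symplDeriv l f).IsHomogeneous (d - 1) := by
  simp only [symplDeriv, Derivation.sub_apply, Derivation.smul_apply, MvPolynomial.smul_eq_C_mul]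
  exact (hf.pderiv.C_mul _).sub (hf.pderiv.C_mul _)

/-- The operator by which `X(λ)` acts on polynomials. -/
def xOp (t : ℂ) (l : ℂ × ℂ) : Module.End ℂ PlanePoly :=
  LinearMap.mulLeft ℂ (linForm l) + t • (degScale ∘ₗ (symplDeriv l).toLinearMap)

theorem xOp_apply (t : ℂ) (l : ℂ × ℂ) (f : PlanePoly) :
    xOp t l f = linForm l * f + t • degScale (symplDeriv l f) := rfl

/-- The representation of the free algebra in which `C` acts as `t` times the projection onto
constants. -/
def polyRep (t : ℂ) : FA →ₐ[ℂ] Module.End ℂ PlanePoly :=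
  FreeAlgebra.lift ℂ ![xOp t (1, 0), xOp t (0, 1)]

theorem polyRep_Xg_zero (t : ℂ) : polyRep t (Xg 0) = xOp t (1, 0) := by simp [polyRep, Xg]

theorem polyRep_Xg_one (t : ℂ) : polyRep t (Xg 1) = xOp t (0, 1) := by simp [polyRep, Xg]

theorem polyRep_Xs (t : ℂ) (l : ℂ × ℂ) : polyRep t (Xs l) = xOp t l := by
  rw [Xs, map_add, map_smul, map_smul, polyRep_Xg_zero, polyRep_Xg_one]
  refine LinearMap.ext fun f => ?_
  simp only [LinearMap.add_apply, LinearMap.smul_apply, xOp_apply, linForm, symplDeriv,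
    Derivation.sub_apply, Derivation.smul_apply, map_sub, map_smul, one_smul,
    zero_smul, add_zero, zero_add, sub_zero, zero_sub, add_mul, smul_mul_assoc]
  rw [Derivation.coe_neg, Pi.neg_apply, map_neg]
  module

theorem xOp_apply_of_isHomogeneous (t : ℂ) (l : ℂ × ℂ) {f : PlanePoly} {d : ℕ}
    (hf : f.IsHomogeneous d) :
    xOp t l f = linForm l * f +
      (t * ((((d - 1 : ℕ) : ℂ) + 1) * ((d - 1 : ℕ) + 2))⁻¹) • symplDeriv l f := by
  rw [xOp_apply, degScale_apply (isHomogeneous_symplDeriv l hf), smul_smul]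

theorem pderiv_one_pderiv_zero (f : PlanePoly) :
    MvPolynomial.pderiv 1 (MvPolynomial.pderiv 0 f) =
      MvPolynomial.pderiv 0 (MvPolynomial.pderiv 1 f) := by
  induction f using MvPolynomial.induction_on with
  | C z => simp
  | add f g hf hg => simp only [map_add, hf, hg]
  | mul_X f i hf =>
    fin_cases i <;> simp [Derivation.leibniz, MvPolynomial.pderiv_X, hf, add_comm]

open MvPolynomial in
theorem polyRep_Cc_of_isHomogeneous (t : ℂ) {f : PlanePoly} {d : ℕ} (hf : f.IsHomogeneous d) :
    polyRep t Cc f = C (t * constantCoeff f) := by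
  have hx : linForm (1, 0) = X 0 := by simp [linForm]
  have hy : linForm (0, 1) = X 1 := by simp [linForm]
  have hdx (g : PlanePoly) : symplDeriv (1, 0) g = pderiv 1 g := by simp [symplDeriv]
  have hdy (g : PlanePoly) : symplDeriv (0, 1) g = -pderiv 0 g := by simp [symplDeriv]
  have hxf := (isHomogeneous_X ℂ (0 : Fin 2)).mul hf
  have hyf := (isHomogeneous_X ℂ (1 : Fin 2)).mul hf
  have euler : X 0 * pderiv 0 f + X 1 * pderiv 1 f = (d : ℂ) • f := by
    have := hf.sum_X_mul_pderiv
    rw [Fin.sum_univ_two] at this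
    rw [this, Nat.cast_smul_eq_nsmul]
  rw [Cc, map_sub, map_mul, map_mul, polyRep_Xg_zero, polyRep_Xg_one]
  simp only [LinearMap.sub_apply, Module.End.mul_apply]
  rw [xOp_apply_of_isHomogeneous t (0, 1) hf, xOp_apply_of_isHomogeneous t (1, 0) hf]
  simp only [map_add, map_smul, hx, hy, hdx, hdy, map_neg]
  rw [xOp_apply_of_isHomogeneous t _ hxf, xOp_apply_of_isHomogeneous t _ hyf,
    xOp_apply_of_isHomogeneous t _ (hf.pderiv (i := 0)),
    xOp_apply_of_isHomogeneous t _ (hf.pderiv (i := 1))]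
  simp only [hx, hy, hdx, hdy, Derivation.leibniz, pderiv_X_self, pderiv_one_pderiv_zero,
    smul_eq_mul, mul_one, Nat.add_sub_cancel_left]
  rcases d with _ | n
  · obtain ⟨z, rfl⟩ : ∃ z, f = C z := ⟨_, totalDegree_eq_zero_iff_eq_C.1
      ((totalDegree_zero_iff_isHomogeneous _).2 hf)⟩
    simp only [pderiv_C]
    have hC : (C (t * z) : PlanePoly) = t • C z := by rw [smul_eq_C_mul, C_mul]
    simp only [map_zero, mul_zero, smul_zero, neg_zero, add_zero, zero_add, constantCoeff_C, hC,
      Nat.cast_zero]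
    rw [mul_left_comm (X 0) (X 1)]
    match_scalars
    · ring
    · ring
  · have h0 : constantCoeff f = 0 := by
      rw [constantCoeff_eq]
      exact hf.coeff_eq_zero (by simp)
    have h1 : (n : ℂ) + 1 ≠ 0 := Nat.cast_add_one_ne_zero n
    have h2 : (n : ℂ) + 2 ≠ 0 := by exact_mod_cast Nat.succ_ne_zero (n + 1)
    have h3 : (n : ℂ) + 1 + 2 ≠ 0 := by exact_mod_cast Nat.succ_ne_zero (n + 2)
    have h4 : (n : ℂ) + 1 + 1 ≠ 0 := by exact_mod_cast Nat.succ_ne_zero (n + 1)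
    rw [h0, mul_zero, map_zero]
    rw [← eq_sub_iff_add_eq'] at euler
    simp only [Nat.add_sub_cancel, Nat.cast_add, Nat.cast_one] at euler ⊢
    rw [euler, mul_left_comm (X 0) (X 1)]
    match_scalars
    · ring
    · field_simp
      ring
    · ring
    · ring

theorem polyRep_Cc (t : ℂ) (f : PlanePoly) :
    polyRep t Cc f = MvPolynomial.C (t * MvPolynomial.constantCoeff f) := by
  induction f using MvPolynomial.induction_on' with
  | monomial d z =>
    exact polyRep_Cc_of_isHomogeneous t (MvPolynomial.isHomogeneous_monomial z rfl)
  | add f g hf hg => rw [map_add, hf, hg, map_add, mul_add, map_add]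

/-- The functional extracting the coefficients of the powers of `C`, with `C ^ n` sent to
`t ^ n`. -/
def vacuum (t : ℂ) : FA →ₗ[ℂ] ℂ where
  toFun x := MvPolynomial.constantCoeff (polyRep t x 1)
  map_add' x y := by simp
  map_smul' c x := by simp

theorem vacuum_apply (t : ℂ) (x : FA) :
    vacuum t x = MvPolynomial.constantCoeff (polyRep t x 1) := rfl

theorem vacuum_mul_Cc_mul (t : ℂ) (x y : FA) :
    vacuum t (x * Cc * y) = t * vacuum t x * vacuum t y := by
  rw [vacuum_apply, map_mul, map_mul, Module.End.mul_apply, Module.End.mul_apply, polyRep_Cc,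
    ← vacuum_apply]
  rw [← mul_one (MvPolynomial.C (t * _) : PlanePoly), ← MvPolynomial.smul_eq_C_mul, map_smul,
    MvPolynomial.constantCoeff_smul, smul_eq_mul, ← vacuum_apply]
  ring

theorem vacuum_Cc_pow (t : ℂ) (n : ℕ) : vacuum t (Cc ^ n) = t ^ n := by
  induction n with
  | zero => simp [vacuum_apply]
  | succ n ih =>
    have := vacuum_mul_Cc_mul t 1 (Cc ^ n)
    rw [one_mul, ← pow_succ', ih] at this
    rw [this, pow_succ']
    simp [vacuum_apply]

theorem vacuum_aeval_Cc (t : ℂ) (q : Polynomial ℂ) :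
    vacuum t (Polynomial.aeval Cc q) = q.eval t := by
  induction q using Polynomial.induction_on' with
  | add p q hp hq => rw [map_add, map_add, hp, hq, Polynomial.eval_add]
  | monomial n c =>
    rw [Polynomial.aeval_monomial, ← Algebra.smul_def, map_smul, vacuum_Cc_pow,
      Polynomial.eval_monomial, smul_eq_mul]

theorem constantCoeff_linForm (l : ℂ × ℂ) : MvPolynomial.constantCoeff (linForm l) = 0 := by
  simp [linForm]

theorem xOp_pow_mul_pow (t : ℂ) (l m k : ℂ × ℂ) (p q : ℕ) :
    xOp t l (linForm m ^ p * linForm k ^ q) = linForm l * (linForm m ^ p * linForm k ^ q) +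
      (t * ((((p + q - 1 : ℕ) : ℂ) + 1) * ((p + q - 1 : ℕ) + 2))⁻¹) •
        ((p * bra l m) • (linForm m ^ (p - 1) * linForm k ^ q) +
          (q * bra l k) • (linForm m ^ p * linForm k ^ (q - 1))) := by
  have h := ((isHomogeneous_linForm m).pow p).mul ((isHomogeneous_linForm k).pow q)
  rw [one_mul, one_mul] at h
  rw [xOp_apply_of_isHomogeneous t l h]
  congr 2
  simp only [Derivation.leibniz, Derivation.leibniz_pow, symplDeriv_linForm, smul_eq_mul,
    nsmul_eq_mul, MvPolynomial.smul_eq_C_mul, map_mul, map_natCast]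
  ring

theorem polyRep_subsetSum (t : ℂ) (n r : ℕ) :
    polyRep t (subsetSum n r) 1 =
      (n.choose r : ℂ) • (linForm (1, 0) ^ r * linForm (0, 1) ^ (n - r)) := by
  have b₁ : bra (1, 0) (1, 0) = 0 := by simp [bra]
  have b₂ : bra (1, 0) (0, 1) = 1 := by simp [bra]
  have b₃ : bra (0, 1) (1, 0) = -1 := by simp [bra]
  have b₄ : bra (0, 1) (0, 1) = 0 := by simp [bra]
  induction n generalizing r with
  | zero => cases r <;> simp [subsetSum_zero_zero, subsetSum_zero_succ]
  | succ n ih =>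
    cases r with
    | zero =>
      rw [subsetSum_succ_zero, map_mul, Module.End.mul_apply, ih, map_smul, polyRep_Xg_one,
        xOp_pow_mul_pow, b₄]
      simp [pow_succ']
    | succ r =>
      rw [subsetSum_succ_succ, map_add, map_mul, map_mul, LinearMap.add_apply,
        Module.End.mul_apply, Module.End.mul_apply, ih, ih, map_smul, map_smul, polyRep_Xg_zero,
        polyRep_Xg_one, xOp_pow_mul_pow, xOp_pow_mul_pow, b₁, b₂, b₃, b₄]
      rcases lt_or_ge r n with hr | hr
      · obtain ⟨s, rfl⟩ := Nat.exists_eq_add_of_lt hr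
        have e₁ : r + s + 1 + 1 - (r + 1) = s + 1 := by omega
        have e₂ : r + s + 1 - (r + 1) = s := by omega
        have e₃ : r + s + 1 - r = s + 1 := by omega
        have e₄ : r + (s + 1) - 1 = r + s := by omega
        have e₅ : r + 1 + s - 1 = r + s := by omega
        have hch := Nat.choose_succ_right_eq (r + s + 1) r
        rw [e₃] at hch
        have hch' : ((r + s + 1).choose (r + 1) : ℂ) * (r + 1) =
            (r + s + 1).choose r * (s + 1) := by exact_mod_cast hch
        rw [e₁, e₂, e₃, e₄, e₅, Nat.choose_succ_succ' (r + s + 1) r,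
          Nat.add_sub_cancel, Nat.add_sub_cancel]
        set κ : ℂ := t * ((((r + s : ℕ) : ℂ) + 1) * ((r + s : ℕ) + 2))⁻¹
        have hC := congrArg (MvPolynomial.C (σ := Fin 2)) hch'
        simp only [MvPolynomial.smul_eq_C_mul, map_mul, map_add, map_natCast, map_one, map_zero,
          map_neg, mul_zero, zero_mul, zero_add, add_zero, Nat.cast_add, Nat.cast_one] at hC ⊢
        linear_combination -(MvPolynomial.C κ * linForm (1, 0) ^ r * linForm (0, 1) ^ s) * hC
      · have hz : n.choose (r + 1) = 0 := Nat.choose_eq_zero_of_lt (by omega)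
        have e₁ : n + 1 - (r + 1) = 0 := by omega
        have e₂ : n - r = 0 := by omega
        rw [e₁, e₂, Nat.choose_succ_succ, hz]
        simp [pow_succ']

theorem vacuum_symXX (t : ℂ) {p : ℕ × ℕ} (hp : p ≠ (0, 0)) : vacuum t (symXX p.1 p.2) = 0 := by
  rw [symXX_eq_smul_subsetSum, map_smul, vacuum_apply, polyRep_subsetSum]
  have : p.1 ≠ 0 ∨ p.2 ≠ 0 := by
    by_contra! h
    exact hp (Prod.ext h.1 h.2)
  rcases this with h | h <;> simp [h, constantCoeff_linForm]

theorem vacuum_chainOf (t : ℂ) {l : List (ℕ × ℕ)} (h : ∃ p ∈ l, p ≠ (0, 0)) :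
    vacuum t (chainOf l) = 0 := by
  induction l with
  | nil => simp at h
  | cons p l ih =>
    rcases eq_or_ne l [] with rfl | hl
    · rw [chainOf_singleton]
      exact vacuum_symXX t (by simpa using h)
    · rw [chainOf_cons _ hl, vacuum_mul_Cc_mul]
      by_cases hp : p = (0, 0)
      · rw [ih (by simpa [hp] using h), mul_zero]
      · rw [vacuum_symXX t hp, mul_zero, zero_mul]

theorem vacuum_eq_zero_of_mem (t : ℂ) {x : FA} (hx : x ∈ Submodule.span ℂ posChainSet) :
    vacuum t x = 0 := by
  have : Submodule.span ℂ posChainSet ≤ LinearMap.ker (vacuum t) := by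
    refine Submodule.span_le.2 ?_
    rintro _ ⟨l, -, h, rfl⟩
    exact vacuum_chainOf t h
  exact this hx

theorem mem_span_posChainSet {x : FA} (hx : ∀ t, vacuum t x = 0) :
    x ∈ Submodule.span ℂ posChainSet := by
  obtain ⟨p, hp, q, rfl⟩ := exists_mem_posChainSpan_add_aeval x
  have : q = 0 := Polynomial.funext fun t => by
    simpa [vacuum_eq_zero_of_mem t hp, vacuum_aeval_Cc] using hx t
  simpa [this] using hp

theorem constantCoeff_xOp_pow_linForm_mul (t : ℂ) (l : ℂ × ℂ) (n : ℕ) {f : PlanePoly} {d : ℕ}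
    (hf : f.IsHomogeneous d) :
    MvPolynomial.constantCoeff ((xOp t l ^ n) (linForm l * f)) = 0 := by
  induction n generalizing f d with
  | zero => simp [constantCoeff_linForm]
  | succ n ih =>
    have hlf := (isHomogeneous_linForm l).mul hf
    have hD : symplDeriv l (linForm l * f) = linForm l * symplDeriv l f := by
      simp [Derivation.leibniz, symplDeriv_linForm, bra, mul_comm l.2]
    rw [pow_succ, Module.End.mul_apply, xOp_apply_of_isHomogeneous t l hlf, hD, map_add, map_add,
      map_smul, MvPolynomial.constantCoeff_smul, ih hlf, ih (isHomogeneous_symplDeriv l hf),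
      smul_zero, add_zero]

theorem constantCoeff_xOp_pow_succ (t : ℂ) (l m k : ℂ × ℂ) (n p q : ℕ) :
    MvPolynomial.constantCoeff ((xOp t l ^ (n + 1)) (linForm m ^ p * linForm k ^ q)) =
      t * ((((p + q - 1 : ℕ) : ℂ) + 1) * ((p + q - 1 : ℕ) + 2))⁻¹ *
        (p * bra l m *
            MvPolynomial.constantCoeff ((xOp t l ^ n) (linForm m ^ (p - 1) * linForm k ^ q)) +
          q * bra l k *
            MvPolynomial.constantCoeff ((xOp t l ^ n) (linForm m ^ p * linForm k ^ (q - 1)))) := by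
  have h := ((isHomogeneous_linForm m).pow p).mul ((isHomogeneous_linForm k).pow q)
  rw [pow_succ, Module.End.mul_apply, xOp_pow_mul_pow, map_add, map_add,
    constantCoeff_xOp_pow_linForm_mul t l n h, zero_add]
  simp only [map_smul, map_add, MvPolynomial.constantCoeff_smul, smul_eq_mul]

theorem constantCoeff_xOp_pow_of_ne (t : ℂ) (l m k : ℂ × ℂ) {n p q : ℕ} (h : p + q ≠ n) :
    MvPolynomial.constantCoeff ((xOp t l ^ n) (linForm m ^ p * linForm k ^ q)) = 0 := by
  induction n generalizing p q with
  | zero =>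
    have : p ≠ 0 ∨ q ≠ 0 := by omega
    rcases this with h | h <;> simp [constantCoeff_linForm, h]
  | succ n ih =>
    have hp : (p : ℂ) * bra l m * MvPolynomial.constantCoeff
        ((xOp t l ^ n) (linForm m ^ (p - 1) * linForm k ^ q)) = 0 := by
      cases p with
      | zero => simp
      | succ p => rw [ih (by omega), mul_zero]
    have hq : (q : ℂ) * bra l k * MvPolynomial.constantCoeff
        ((xOp t l ^ n) (linForm m ^ p * linForm k ^ (q - 1))) = 0 := by
      cases q with
      | zero => simp
      | succ q => rw [ih (by omega), mul_zero]
    rw [constantCoeff_xOp_pow_succ, hp, hq, add_zero, mul_zero]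

theorem constantCoeff_xOp_pow (t : ℂ) (l m k : ℂ × ℂ) {n p q : ℕ} (h : p + q = n) :
    MvPolynomial.constantCoeff ((xOp t l ^ n) (linForm m ^ p * linForm k ^ q)) =
      t ^ n / (n + 1).factorial * (bra l m ^ p * bra l k ^ q) := by
  induction n generalizing p q with
  | zero =>
    obtain ⟨rfl, rfl⟩ : p = 0 ∧ q = 0 := by omega
    simp
  | succ n ih =>
    have hp : (p : ℂ) * bra l m * MvPolynomial.constantCoeff
        ((xOp t l ^ n) (linForm m ^ (p - 1) * linForm k ^ q)) =
        p * (t ^ n / (n + 1).factorial * (bra l m ^ p * bra l k ^ q)) := by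
      cases p with
      | zero => simp
      | succ p => rw [ih (by omega), Nat.add_sub_cancel]; ring
    have hq : (q : ℂ) * bra l k * MvPolynomial.constantCoeff
        ((xOp t l ^ n) (linForm m ^ p * linForm k ^ (q - 1))) =
        q * (t ^ n / (n + 1).factorial * (bra l m ^ p * bra l k ^ q)) := by
      cases q with
      | zero => simp
      | succ q => rw [ih (by omega), Nat.add_sub_cancel]; ring
    have hpq : (p : ℂ) + q = n + 1 := by exact_mod_cast h
    have h₁ : (n : ℂ) + 1 ≠ 0 := Nat.cast_add_one_ne_zero n
    have h₂ : (n : ℂ) + 2 ≠ 0 := by exact_mod_cast Nat.succ_ne_zero (n + 1)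
    have h₃ : ((n + 1).factorial : ℂ) ≠ 0 := Nat.cast_ne_zero.2 (Nat.factorial_ne_zero _)
    have h₄ : ((n + 1 + 1).factorial : ℂ) = (n + 2) * (n + 1).factorial := by
      rw [Nat.factorial_succ]; push_cast; ring
    rw [constantCoeff_xOp_pow_succ, hp, hq, ← add_mul, hpq, h, Nat.add_sub_cancel, h₄]
    field_simp
    ring

/-- The constant term of `X(λ₁)ⁿ X(λ₂)ᵐ` applied to `(λ₂·x)ᵖ (λ₃·x)^q`. -/
def vacuumPair (t : ℂ) (l₁ l₂ l₃ : ℂ × ℂ) (n m p q : ℕ) : ℂ :=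
  MvPolynomial.constantCoeff
    ((xOp t l₁ ^ n) ((xOp t l₂ ^ m) (linForm l₂ ^ p * linForm l₃ ^ q)))

theorem bra_self (l : ℂ × ℂ) : bra l l = 0 := by rw [bra, mul_comm, sub_self]

theorem vacuumPair_succ (t : ℂ) (l₁ l₂ l₃ : ℂ × ℂ) (n m p q : ℕ) :
    vacuumPair t l₁ l₂ l₃ n (m + 1) p q = vacuumPair t l₁ l₂ l₃ n m (p + 1) q +
      t * ((((p + q - 1 : ℕ) : ℂ) + 1) * ((p + q - 1 : ℕ) + 2))⁻¹ *
        (q * bra l₂ l₃ * vacuumPair t l₁ l₂ l₃ n m p (q - 1)) := by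
  rw [vacuumPair, pow_succ (xOp t l₂), Module.End.mul_apply, xOp_pow_mul_pow, bra_self, mul_zero,
    zero_smul, zero_add, ← mul_assoc (linForm l₂), ← pow_succ']
  simp only [map_smul, map_add, MvPolynomial.constantCoeff_smul, smul_eq_mul, vacuumPair]

theorem vacuumPair_eq_zero (t : ℂ) (l₁ l₂ l₃ : ℂ × ℂ) {n m p q : ℕ} (h : p + q + m < n) :
    vacuumPair t l₁ l₂ l₃ n m p q = 0 := by
  induction m generalizing p q with
  | zero => simpa using! constantCoeff_xOp_pow_of_ne t l₁ l₂ l₃ (by omega : p + q ≠ n)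
  | succ m ih => rw [vacuumPair_succ, ih (by omega), ih (by omega), mul_zero, mul_zero, add_zero]

theorem choose_div_descFactorial_recurrence {m j n p q : ℕ} (hj : j ≤ q)
    (h : n + 2 * j + 1 = p + q + m + 1) :
    ((m + 1).choose (j + 1) : ℂ) * (q + 1).descFactorial (j + 1) /
        ((p + q + 1).descFactorial (j + 1) * (n + j + 2).factorial) =
      m.choose (j + 1) * (q + 1).descFactorial (j + 1) /
        ((p + q + 2).descFactorial (j + 1) * (n + j + 2).factorial) +
      (((p + q : ℕ) + 1 : ℂ) * ((p + q : ℕ) + 2))⁻¹ * (q + 1) *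
        (m.choose j * q.descFactorial j /
          ((p + q).descFactorial j * (n + j + 1).factorial)) := by
  have hch : (m.choose (j + 1) : ℂ) * (j + 1) = m.choose j * (m - j) := by
    rcases le_or_gt j m with hjm | hjm
    · have := Nat.choose_succ_right_eq m j
      rw [← Nat.cast_sub hjm]
      exact_mod_cast this
    · simp [Nat.choose_eq_zero_of_lt hjm, Nat.choose_eq_zero_of_lt (hjm.trans (Nat.lt_succ_self j))]
  have hd : ((p + q : ℂ) + 1 - j) * (p + q + 1).descFactorial j =
      (p + q + 1) * (p + q).descFactorial j := by
    have := Nat.succ_descFactorial (p + q) j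
    have hle : j ≤ p + q + 1 := by omega
    have hc := congrArg (Nat.cast (R := ℂ)) this
    push_cast [Nat.cast_sub hle] at hc
    exact hc
  have ha : ((p + q).descFactorial j : ℂ) ≠ 0 :=
    Nat.cast_ne_zero.2 (Nat.descFactorial_pos.2 (by omega)).ne'
  have hb : ((p + q + 1).descFactorial j : ℂ) ≠ 0 :=
    Nat.cast_ne_zero.2 (Nat.descFactorial_pos.2 (by omega)).ne'
  have hF : ((n + j + 1).factorial : ℂ) ≠ 0 := Nat.cast_ne_zero.2 (Nat.factorial_ne_zero _)
  have h₁ : (p + q : ℂ) + 1 ≠ 0 := by exact_mod_cast Nat.succ_ne_zero (p + q)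
  have h₂ : (p + q : ℂ) + 2 ≠ 0 := by exact_mod_cast Nat.succ_ne_zero (p + q + 1)
  have h₃ : (n + j : ℂ) + 2 ≠ 0 := by exact_mod_cast Nat.succ_ne_zero (n + j + 1)
  have hn : (n : ℂ) = p + q + m - 2 * j := by
    have : (n : ℂ) + 2 * j + 1 = p + q + m + 1 := by exact_mod_cast h
    linear_combination this
  rw [Nat.choose_succ_succ', Nat.succ_descFactorial_succ q j, Nat.succ_descFactorial_succ (p + q) j,
    Nat.succ_descFactorial_succ (p + q + 1) j, Nat.factorial_succ (n + j + 1)]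
  push_cast
  rw [show (p + q : ℂ) + 1 + 1 = p + q + 2 by ring, show (n + j : ℂ) + 1 + 1 = n + j + 2 by ring]
  field_simp
  linear_combination (q.descFactorial j : ℂ) * (((p + q + 1).descFactorial j : ℂ) * hch +
    (m.choose (j + 1) : ℂ) * hd - (m.choose j : ℂ) * ((p + q + 1).descFactorial j : ℂ) * hn)

theorem vacuumPair_eq (t : ℂ) (l₁ l₂ l₃ : ℂ × ℂ) {n m p q j : ℕ} (h : n + 2 * j = p + q + m) :
    vacuumPair t l₁ l₂ l₃ n m p q =
      t ^ (n + j) * (m.choose j * q.descFactorial j /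
        ((p + q).descFactorial j * (n + j + 1).factorial)) *
        (bra l₂ l₃ ^ j * bra l₁ l₂ ^ (p + m - j) * bra l₁ l₃ ^ (q - j)) := by
  induction m generalizing p q j with
  | zero =>
    cases j with
    | zero =>
      have := constantCoeff_xOp_pow t l₁ l₂ l₃ (by omega : p + q = n)
      simp only [vacuumPair, pow_zero, Module.End.one_apply, this]
      simp only [Nat.choose_zero_right, Nat.descFactorial_zero, Nat.sub_zero, add_zero,
        Nat.cast_one, one_mul, mul_one]
      ring
    | succ j =>
      have := constantCoeff_xOp_pow_of_ne t l₁ l₂ l₃ (by omega : p + q ≠ n)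
      simp only [vacuumPair, pow_zero, Module.End.one_apply, this]
      simp
  | succ m ih =>
    rw [vacuumPair_succ]
    cases j with
    | zero =>
      have hq : (q : ℂ) * bra l₂ l₃ * vacuumPair t l₁ l₂ l₃ n m p (q - 1) = 0 := by
        cases q with
        | zero => simp
        | succ q => rw [vacuumPair_eq_zero _ _ _ _ (by omega), mul_zero]
      rw [hq, ih (j := 0) (by omega), Nat.add_right_comm p 1 m]
      simp [add_assoc]
    | succ j =>
      rw [ih (p := p + 1) (j := j + 1) (by omega)]
      cases q with
      | zero => simp
      | succ q =>
        have e₁ : p + 1 + m - (j + 1) = p + m - j := by omega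
        have e₂ : p + (m + 1) - (j + 1) = p + m - j := by omega
        have e₃ : q + 1 - (j + 1) = q - j := by omega
        have e₄ : p + 1 + (q + 1) = p + q + 2 := by omega
        have e₅ : p + (q + 1) - 1 = p + q := by omega
        rw [Nat.add_sub_cancel, ih (p := p) (q := q) (j := j) (by omega), e₁, e₂, e₃, e₄, e₅,
          ← add_assoc p q 1, ← add_assoc n j 1, add_assoc (n + j) 1 1]
        rcases le_or_gt j q with hj | hj
        · have hrec := choose_div_descFactorial_recurrence (m := m) (n := n) (p := p) hj (by omega)
          rw [hrec]
          push_cast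
          ring
        · have hz : q.descFactorial j = 0 := Nat.descFactorial_eq_zero_iff_lt.2 hj
          have hz' : (q + 1).descFactorial (j + 1) = 0 :=
            Nat.descFactorial_eq_zero_iff_lt.2 (by omega)
          rw [hz, hz']
          simp only [Nat.cast_zero, mul_zero, zero_div, zero_mul, add_zero]

theorem xOp_pow_one (t : ℂ) (l : ℂ × ℂ) (n : ℕ) : (xOp t l ^ n) 1 = linForm l ^ n := by
  induction n with
  | zero => simp
  | succ n ih =>
    have h := xOp_pow_mul_pow t l l l n 0
    rw [bra_self, pow_zero, mul_one] at h
    rw [pow_succ', Module.End.mul_apply, ih, h, pow_succ']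
    simp

theorem vacuum_pow_mul_pow_mul_pow (t : ℂ) (a b c : ℕ) (l₁ l₂ l₃ : ℂ × ℂ) :
    vacuum t (Xs l₁ ^ (a + b) * Xs l₂ ^ (a + c) * Xs l₃ ^ (b + c)) =
      (bra l₁ l₂ ^ a * bra l₁ l₃ ^ b * bra l₂ l₃ ^ c * (Nat.choose (a + c) c : ℂ)) /
        ((a + b + c + 1).factorial : ℂ) * t ^ (a + b + c) := by
  have h := vacuumPair_eq t l₁ l₂ l₃
    (by omega : a + b + 2 * c = 0 + (b + c) + (a + c))
  have hd : ((b + c).descFactorial c : ℂ) ≠ 0 :=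
    Nat.cast_ne_zero.2 (Nat.descFactorial_pos.2 (Nat.le_add_left c b)).ne'
  have e : 0 + (a + c) - c = a := by omega
  rw [e, zero_add, Nat.add_sub_cancel, mul_div_mul_comm, div_mul_eq_mul_div] at h
  rw [vacuum_apply, map_mul, map_mul, map_pow, map_pow, map_pow, polyRep_Xs, polyRep_Xs,
    polyRep_Xs, Module.End.mul_apply, Module.End.mul_apply, xOp_pow_one]
  rw [vacuumPair, pow_zero, one_mul] at h
  rw [h]
  field_simp

theorem statement7 (a b c : ℕ) (l₁ l₂ l₃ : ℂ × ℂ) :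
    Xs l₁ ^ (a + b) * Xs l₂ ^ (a + c) * Xs l₃ ^ (b + c) -
        ((bra l₁ l₂ ^ a * bra l₁ l₃ ^ b * bra l₂ l₃ ^ c *
            (Nat.choose (a + c) c : ℂ)) / ((a + b + c + 1).factorial : ℂ)) • Cc ^ (a + b + c) ∈
      Submodule.span ℂ posChainSet := by
  refine mem_span_posChainSet fun t => ?_
  rw [map_sub, map_smul, vacuum_pow_mul_pow_mul_pow, vacuum_Cc_pow, smul_eq_mul, sub_self]

end
end

section
/- The so(32) trace identity tr_{Ad}(X⁶) = 15·tr_F(X²)·tr_F(X⁴) holds for all X ∈ so(32), where F is the 32-dimensional fundamental (vector) representation and Ad = Λ²F is the adjoint representation. -/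
section MatrixTrace

open Matrix Finset

attribute [local instance] LieRing.ofAssociativeRing

variable {K n : Type*} [Field K] [Fintype n] [DecidableEq n]

theorem trace_matrix_end_eq_sum (f : Matrix n n K →ₗ[K] Matrix n n K) :
    LinearMap.trace K _ f = ∑ i, ∑ j, f (Matrix.single i j 1) i j := by
  rw [LinearMap.trace_eq_matrix_trace K (Matrix.stdBasis K n n), Matrix.trace,
    Fintype.sum_prod_type]
  refine sum_congr rfl fun i _ => sum_congr rfl fun j _ => ?_
  rw [Matrix.diag_apply, LinearMap.toMatrix_apply, Matrix.stdBasis_eq_single]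
  rfl

theorem trace_mulLeft_mul_mulRight (B C : Matrix n n K) :
    LinearMap.trace K _ (LinearMap.mulLeft K B * LinearMap.mulRight K C) =
      B.trace * C.trace := by
  simp [trace_matrix_end_eq_sum, Matrix.trace, sum_mul_sum, Matrix.mul_apply, Matrix.single_apply,
    ite_and]

theorem trace_mulLeft_mul_mulRight_mul_transpose (B C : Matrix n n K) :
    LinearMap.trace K _ (LinearMap.mulLeft K B * LinearMap.mulRight K C *
      (Matrix.transposeLinearEquiv n n K K).toLinearMap) = (B * Cᵀ).trace := by
  simp [trace_matrix_end_eq_sum, Matrix.trace, Matrix.mul_apply, Matrix.single_apply, ite_and]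

/-- The commutator with an antisymmetric matrix `A` is `M ↦ A * M + M * Aᵀ`. -/
theorem ad_eq_mulLeft_add_mulRight_transpose {A : Matrix n n K}
    (hA : A ∈ LieAlgebra.Orthogonal.so n K) :
    LieAlgebra.ad K (Matrix n n K) A = LinearMap.mulLeft K A + LinearMap.mulRight K Aᵀ := by
  ext1 M
  simp [(LieAlgebra.Orthogonal.mem_so n K A).1 hA, Ring.lie_def, sub_eq_add_neg]

theorem ad_pow_eq_sum {A : Matrix n n K} (hA : A ∈ LieAlgebra.Orthogonal.so n K) (k : ℕ) :
    LieAlgebra.ad K (Matrix n n K) A ^ k = ∑ m ∈ antidiagonal k, k.choose m.1 •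
      (LinearMap.mulLeft K (A ^ m.1) * LinearMap.mulRight K (A ^ m.2)ᵀ) := by
  rw [ad_eq_mulLeft_add_mulRight_transpose hA,
    (LinearMap.commute_mulLeft_right A Aᵀ).add_pow']
  simp [LinearMap.pow_mulLeft, LinearMap.pow_mulRight, Matrix.transpose_pow]

theorem coe_ad_pow_apply {L : Type*} [LieRing L] [LieAlgebra K L] (S : LieSubalgebra K L)
    (x y : S) (k : ℕ) :
    (((LieAlgebra.ad K S x ^ k) y : S) : L) = (LieAlgebra.ad K L x ^ k) y := by
  induction k with
  | zero => simp
  | succ k ih => simp [pow_succ', ih]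

/-- The projection of a matrix onto its antisymmetric part. -/
noncomputable def antisymmetrization (K n : Type*) [Field K] :
    Matrix n n K →ₗ[K] Matrix n n K :=
  (2 : K)⁻¹ • (1 - (Matrix.transposeLinearEquiv n n K K).toLinearMap)

theorem antisymmetrization_mem_so (M : Matrix n n K) :
    antisymmetrization K n M ∈ LieAlgebra.Orthogonal.so n K := by
  rw [LieAlgebra.Orthogonal.mem_so]
  simp [antisymmetrization, ← smul_neg]

theorem antisymmetrization_of_mem_so [NeZero (2 : K)] {M : Matrix n n K}
    (hM : M ∈ LieAlgebra.Orthogonal.so n K) : antisymmetrization K n M = M := by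
  have h := (LieAlgebra.Orthogonal.mem_so n K M).1 hM
  simp [antisymmetrization, h, ← two_smul K M, smul_smul, NeZero.ne]

theorem trace_ad_pow_so_eq_trace_comp [NeZero (2 : K)] {A : Matrix n n K}
    (hA : A ∈ LieAlgebra.Orthogonal.so n K) (k : ℕ) :
    LinearMap.trace K _ (LieAlgebra.ad K (LieAlgebra.Orthogonal.so n K) ⟨A, hA⟩ ^ k) =
      LinearMap.trace K _ (LieAlgebra.ad K (Matrix n n K) A ^ k * antisymmetrization K n) := by
  have hmem (M : Matrix n n K) : (LieAlgebra.ad K (Matrix n n K) A ^ k * antisymmetrization K n) M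
      ∈ (LieAlgebra.Orthogonal.so n K).toSubmodule := by
    have := coe_ad_pow_apply (LieAlgebra.Orthogonal.so n K) ⟨A, hA⟩
      ⟨_, antisymmetrization_mem_so M⟩ k
    rw [Module.End.mul_apply, ← this]
    exact SetLike.coe_mem _
  rw [← LinearMap.trace_restrict_eq_of_forall_mem _ _ hmem]
  congr 1
  ext1 M
  apply Subtype.ext
  rw [LinearMap.coe_restrict_apply, Module.End.mul_apply, antisymmetrization_of_mem_so M.2]
  exact coe_ad_pow_apply _ _ M k

theorem two_mul_trace_ad_pow_so [NeZero (2 : K)] {A : Matrix n n K}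
    (hA : A ∈ LieAlgebra.Orthogonal.so n K) (k : ℕ) :
    2 * LinearMap.trace K _ (LieAlgebra.ad K (LieAlgebra.Orthogonal.so n K) ⟨A, hA⟩ ^ k) =
      (∑ m ∈ antidiagonal k, (k.choose m.1 : K) * ((A ^ m.1).trace * (A ^ m.2).trace)) -
        2 ^ k * (A ^ k).trace := by
  have htwist : LinearMap.trace K _ (LieAlgebra.ad K (Matrix n n K) A ^ k *
      (Matrix.transposeLinearEquiv n n K K).toLinearMap) = 2 ^ k * (A ^ k).trace := by
    rw [ad_pow_eq_sum hA, sum_mul, map_sum]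
    simp_rw [smul_mul_assoc, map_nsmul, trace_mulLeft_mul_mulRight_mul_transpose,
      Matrix.transpose_transpose, ← pow_add]
    rw [sum_congr rfl fun m hm => by rw [mem_antidiagonal.1 hm], ← sum_smul,
      Nat.sum_antidiagonal_eq_sum_range_succ_mk, Nat.sum_range_choose, nsmul_eq_mul]
    push_cast
    rfl
  rw [trace_ad_pow_so_eq_trace_comp, antisymmetrization, mul_smul_comm, map_smul, smul_eq_mul,
    mul_inv_cancel_left₀ (NeZero.ne 2), mul_sub, mul_one, map_sub, htwist, ad_pow_eq_sum hA,
    map_sum]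
  simp_rw [map_nsmul, trace_mulLeft_mul_mulRight, Matrix.trace_transpose, nsmul_eq_mul]

theorem trace_pow_eq_zero_of_odd [NeZero (2 : K)] {A : Matrix n n K}
    (hA : A ∈ LieAlgebra.Orthogonal.so n K) {k : ℕ} (hk : Odd k) : (A ^ k).trace = 0 := by
  have h := Matrix.trace_transpose (A ^ k)
  rw [Matrix.transpose_pow, (LieAlgebra.Orthogonal.mem_so n K A).1 hA, hk.neg_pow,
    Matrix.trace_neg] at h
  have h2 : 2 * (A ^ k).trace = 0 := by linear_combination -h
  exact (mul_eq_zero.1 h2).resolve_left (NeZero.ne 2)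

theorem trace_ad_pow_six_so [NeZero (2 : K)] {A : Matrix n n K}
    (hA : A ∈ LieAlgebra.Orthogonal.so n K) :
    LinearMap.trace K _ (LieAlgebra.ad K (LieAlgebra.Orthogonal.so n K) ⟨A, hA⟩ ^ 6) =
      (Fintype.card n - 32) * (A ^ 6).trace + 15 * (A ^ 2).trace * (A ^ 4).trace := by
  have h := two_mul_trace_ad_pow_so hA 6
  have h1 : A.trace = 0 := by simpa using trace_pow_eq_zero_of_odd hA odd_one
  have h3 : (A ^ 3).trace = 0 := trace_pow_eq_zero_of_odd hA (by decide)
  simp [Nat.sum_antidiagonal_eq_sum_range_succ_mk, sum_range_succ, Nat.choose, h1, h3] at h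
  apply mul_left_cancel₀ (NeZero.ne (2 : K))
  linear_combination h

end MatrixTrace

/-!
Statement 16: The so(32) trace identity tr_{Ad}(X⁶) = 15·tr_F(X²)·tr_F(X⁴) for all
X ∈ so(32), where F is the 32-dimensional fundamental (vector) representation and the
adjoint trace is the trace of (ad X)⁶ on so(32) = Λ²F.
-/

theorem statement16 (A : Matrix (Fin 32) (Fin 32) ℂ)
    (hA : A ∈ LieAlgebra.Orthogonal.so (Fin 32) ℂ) :
    LinearMap.trace ℂ ↥(LieAlgebra.Orthogonal.so (Fin 32) ℂ)
        ((LieAlgebra.ad ℂ ↥(LieAlgebra.Orthogonal.so (Fin 32) ℂ) ⟨A, hA⟩) ^ 6) =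
      15 * Matrix.trace (A ^ 2) * Matrix.trace (A ^ 4) := by
  simpa using trace_ad_pow_six_so hA
end
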